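/- arXiv:2305.11848 — 3 statements merged into one kernel-verified Lean document; each statement's English description precedes it below -/
import Mathlib

section
/- Let n ≥ 1, let P be a topological space, p₀ ∈ P, α₀ ∈ ℝⁿ, and let q : P × ℝⁿ → ℝⁿ be jointly continuous. Assume: (i) for every p ∈ P the map α ↦ q(p,α) is differentiable, with derivative D_αq : P × ℝⁿ → L(ℝⁿ, ℝⁿ) jointly continuous; (ii) there is C ≥ 0 with ‖D_αq(p,α) − D_αq(p,α')‖ ≤ C‖α − α'‖ for all p ∈ P and α, α' ∈ ℝⁿ; (iii) q(p₀, α₀) = 0; (iv) D_αq(p₀, α₀) is invertible as a linear map. Then there exist an open neighborhood U of p₀, a radius r > 0, and a continuous map a : U → ℝⁿ with a(p₀) = α₀, such that for every p ∈ U, a(p) is the unique point α in the closed ball of radius r centered at α₀ satisfying q(p, α) = 0. -/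
open Set Metric Topology
open scoped NNReal

/-- A family of zeros of functions that are antilipschitz uniformly in the parameter depends
continuously on the parameter. -/
theorem continuousOn_of_antilipschitzWith_of_eq_zero {P E F : Type*} [TopologicalSpace P]
    [PseudoMetricSpace E] [NormedAddCommGroup F] {q : P × E → F} (hq : Continuous q)
    {U : Set P} {s : Set E} {K : ℝ≥0}
    (hanti : ∀ p ∈ U, AntilipschitzWith K (s.domRestrict fun y => q (p, y)))
    {a : P → E} (has : ∀ p ∈ U, a p ∈ s) (ha : ∀ p ∈ U, q (p, a p) = 0) :
    ContinuousOn a U := by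
  intro p hp
  rw [ContinuousWithinAt, tendsto_iff_dist_tendsto_zero]
  have hlim : Filter.Tendsto (fun p' => K * ‖q (p', a p)‖) (𝓝[U] p) (𝓝 0) := by
    have hcont : Continuous fun p' => K * ‖q (p', a p)‖ := by fun_prop
    simpa [ha p hp] using (hcont.tendsto p).mono_left nhdsWithin_le_nhds
  refine squeeze_zero' (Filter.Eventually.of_forall fun _ => dist_nonneg) ?_ hlim
  filter_upwards [self_mem_nhdsWithin] with p' hp'
  simpa [ha p' hp', Subtype.dist_eq] using
    (hanti p' hp').le_mul_dist ⟨a p', has p' hp'⟩ ⟨a p, has p hp⟩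

section ImplicitFunction

variable {P E F : Type*} [TopologicalSpace P]
  [NormedAddCommGroup E] [NormedSpace ℝ E] [NormedAddCommGroup F] [NormedSpace ℝ F]

/-- A function with a jointly continuous partial derivative is approximated by this derivative,
uniformly with respect to nearby parameters. -/
theorem exists_approximatesLinearOn_closedBall_of_continuousAt {q : P × E → F}
    {Dq : P × E → E →L[ℝ] F} {p₀ : P} {x₀ : E} (hDq : ContinuousAt Dq (p₀, x₀))
    (hderiv : ∀ p x, HasFDerivAt (fun y => q (p, y)) (Dq (p, x)) x) {c : ℝ≥0} (hc : 0 < c) :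
    ∃ U : Set P, IsOpen U ∧ p₀ ∈ U ∧ ∃ r : ℝ, 0 < r ∧
      ∀ p ∈ U, ApproximatesLinearOn (fun y => q (p, y)) (Dq (p₀, x₀)) (closedBall x₀ r) c := by
  have hnear : ∀ᶠ z in 𝓝 p₀ ×ˢ 𝓝 x₀, dist (Dq z) (Dq (p₀, x₀)) < c := by
    rw [← nhds_prod_eq]
    exact hDq.eventually (ball_mem_nhds _ (NNReal.coe_pos.2 hc))
  obtain ⟨A, hA, B, hB, hAB⟩ := Filter.eventually_prod_iff.1 hnear
  obtain ⟨U, hUA, hU, hpU⟩ := mem_nhds_iff.1 hA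
  obtain ⟨r, hr, hrB⟩ := nhds_basis_closedBall.mem_iff.1 hB
  refine ⟨U, hU, hpU, r, hr, fun p hp x hx y hy => ?_⟩
  refine (convex_closedBall x₀ r).norm_image_sub_le_of_norm_hasFDerivWithin_le'
    (fun z _ => (hderiv p z).hasFDerivWithinAt) (fun z hz => ?_) hy hx
  rw [← dist_eq_norm]
  exact (hAB (hUA hp) (hrB hz)).le

/-- Implicit function theorem with a parameter in an arbitrary topological space. -/
theorem exists_continuousOn_implicitFunction [CompleteSpace E] [Nontrivial E] {q : P × E → F}
    {Dq : P × E → E →L[ℝ] F} {p₀ : P} {x₀ : E} (hq : Continuous q)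
    (hDq : ContinuousAt Dq (p₀, x₀))
    (hderiv : ∀ p x, HasFDerivAt (fun y => q (p, y)) (Dq (p, x)) x) (h0 : q (p₀, x₀) = 0)
    (e : E ≃L[ℝ] F) (he : (e : E →L[ℝ] F) = Dq (p₀, x₀)) :
    ∃ (U : Set P) (r : ℝ) (a : P → E),
      IsOpen U ∧ p₀ ∈ U ∧ 0 < r ∧ ContinuousOn a U ∧ a p₀ = x₀ ∧
      ∀ p ∈ U, a p ∈ closedBall x₀ r ∧ q (p, a p) = 0 ∧
        ∀ x ∈ closedBall x₀ r, q (p, x) = 0 → x = a p := by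
  set N : ℝ≥0 := ‖(e.symm : F →L[ℝ] E)‖₊
  have hN : 0 < N⁻¹ := inv_pos.2 e.nnnorm_symm_pos
  have hlt : Subsingleton E ∨ N⁻¹ / 2 < N⁻¹ := Or.inr (half_lt_self hN)
  obtain ⟨V, hV, hpV, r, hr, happ⟩ :=
    exists_approximatesLinearOn_closedBall_of_continuousAt hDq hderiv (half_pos hN)
  rw [← he] at happ
  set U : Set P := V ∩ {p | ‖q (p, x₀)‖ < (N⁻¹ - N⁻¹ / 2 : ℝ) * r}
  have hgap : (0 : ℝ) < (N⁻¹ - N⁻¹ / 2 : ℝ) * r := by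
    rw [sub_half]
    exact mul_pos (half_pos (NNReal.coe_pos.2 hN)) hr
  have hU : IsOpen U := hV.inter (isOpen_lt (by fun_prop) continuous_const)
  have hpU : p₀ ∈ U := ⟨hpV, by simpa [h0] using hgap⟩
  have hex : ∀ p ∈ U, ∃ x ∈ closedBall x₀ r, q (p, x) = 0 := fun p hp =>
    (happ p hp.1).surjOn_closedBall_of_nonlinearRightInverse e.toNonlinearRightInverse hr.le
      Subset.rfl (mem_closedBall.2 (by simpa [dist_eq_norm] using hp.2.le))
  choose! a has ha using hex
  have huniq : ∀ p ∈ U, ∀ x ∈ closedBall x₀ r, q (p, x) = 0 → x = a p := fun p hp x hx hqx =>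
    (happ p hp.1).injOn hlt hx (has p hp) (hqx.trans (ha p hp).symm)
  exact ⟨U, r, a, hU, hpU, hr,
    continuousOn_of_antilipschitzWith_of_eq_zero hq
      (fun p hp => (happ p hp.1).antilipschitz hlt) has ha,
    (huniq p₀ hpU x₀ (mem_closedBall_self hr.le) h0).symm,
    fun p hp => ⟨has p hp, ha p hp, huniq p hp⟩⟩

end ImplicitFunction

/-- Theorem 10.2: implicit function theorem with a parameter from a general
topological space: a jointly continuous `q` that is differentiable in `α` with jointly
continuous derivative, Lipschitz in `α` uniformly in the parameter, vanishing at `(p₀, α₀)`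
with invertible `α`-derivative there, can be solved for `α` continuously near `p₀`, uniquely
in a closed ball around `α₀`. -/
theorem stmt_4 (n : ℕ) (hn : 1 ≤ n) (P : Type*) [TopologicalSpace P]
    (p₀ : P) (α₀ : EuclideanSpace ℝ (Fin n))
    (q : P × EuclideanSpace ℝ (Fin n) → EuclideanSpace ℝ (Fin n))
    (Dq : P × EuclideanSpace ℝ (Fin n) →
      EuclideanSpace ℝ (Fin n) →L[ℝ] EuclideanSpace ℝ (Fin n))
    (hq : Continuous q) (hDq : Continuous Dq)
    (hderiv : ∀ (p : P) (α : EuclideanSpace ℝ (Fin n)),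
      HasFDerivAt (fun β => q (p, β)) (Dq (p, α)) α)
    (C : ℝ) (hC : 0 ≤ C)
    (hlip : ∀ (p : P) (α α' : EuclideanSpace ℝ (Fin n)),
      ‖Dq (p, α) - Dq (p, α')‖ ≤ C * ‖α - α'‖)
    (h0 : q (p₀, α₀) = 0)
    (hinv : Function.Bijective (Dq (p₀, α₀))) :
    ∃ (U : Set P) (r : ℝ) (a : P → EuclideanSpace ℝ (Fin n)),
      IsOpen U ∧ p₀ ∈ U ∧ 0 < r ∧ ContinuousOn a U ∧ a p₀ = α₀ ∧
      ∀ p ∈ U, a p ∈ Metric.closedBall α₀ r ∧ q (p, a p) = 0 ∧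
        ∀ α ∈ Metric.closedBall α₀ r, q (p, α) = 0 → α = a p := by
  have : NeZero n := ⟨by omega⟩
  exact exists_continuousOn_implicitFunction hq hDq.continuousAt hderiv h0
    (.ofBijective (Dq (p₀, α₀)) (LinearMap.ker_eq_bot.2 hinv.1) (LinearMap.range_eq_top.2 hinv.2))
    (ContinuousLinearEquiv.coe_ofBijective ..)
end

section
/- Let d, l ≥ 1 and l₁, l₂ ≥ 0. Let P₂ denote the set of Borel probability measures on ℝ^d with finite second moment, and for μ ∈ P₂ write ‖μ‖₂ := (∫‖x‖² dμ(x))^{1/2}. Let h : P₂ → ℝ^l and δh : P₂ × ℝ^d → ℝ^l be such that: (i) for every μ ∈ P₂ the map x ↦ δh(μ)(x) is differentiable with ‖∂_x δh(μ)(x)‖ ≤ l₁ + l₂‖x‖ for all x ∈ ℝ^d; (ii) δh is a linear functional derivative of h, i.e., for all ν₁, ν₂ ∈ P₂ all the integrals below are finite and h(ν₁) − h(ν₂) = ∫₀¹ (∫ δh(θν₁+(1−θ)ν₂)(x) dν₁(x) − ∫ δh(θν₁+(1−θ)ν₂)(x) dν₂(x)) dθ. Then for all μ, μ' ∈ P₂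 and every coupling π of μ and μ': ‖h(μ) − h(μ')‖ ≤ l₁ ∫ ‖x − x'‖ dπ(x,x') + l₂ (‖μ‖₂ + ‖μ'‖₂) (∫ ‖x − x'‖² dπ(x,x'))^{1/2}. In particular, when l₂ = 0, ‖h(μ) − h(μ')‖ ≤ l₁ ∫ ‖x − x'‖ dπ(x,x'). -/
open MeasureTheory

/-- Probability measures on `ℝ^d` with finite second moment. -/
def MemP2 {d : ℕ} (μ : Measure (EuclideanSpace ℝ (Fin d))) : Prop :=
  IsProbabilityMeasure μ ∧ Integrable (fun x => ‖x‖ ^ 2) μ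

/-- `π` is a coupling of `μ` and `ν`. -/
def IsCoupling {d : ℕ} (π : Measure (EuclideanSpace ℝ (Fin d) × EuclideanSpace ℝ (Fin d)))
    (μ ν : Measure (EuclideanSpace ℝ (Fin d))) : Prop :=
  IsProbabilityMeasure π ∧ π.map Prod.fst = μ ∧ π.map Prod.snd = ν

/-- The convex combination `θ ν₁ + (1 − θ) ν₂` of measures. -/
noncomputable def mix {d : ℕ} (θ : ℝ) (ν₁ ν₂ : Measure (EuclideanSpace ℝ (Fin d))) :
    Measure (EuclideanSpace ℝ (Fin d)) :=
  ENNReal.ofReal θ • ν₁ + ENNReal.ofReal (1 - θ) • ν₂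

/-- Cauchy–Schwarz for the integral of a product of norms. -/
lemma integral_norm_mul_norm_le_sqrt_mul_sqrt {α E F : Type*} [MeasurableSpace α]
    [NormedAddCommGroup E] [NormedAddCommGroup F] {μ : Measure α} {f : α → E} {g : α → F}
    (hf : MemLp f 2 μ) (hg : MemLp g 2 μ) :
    ∫ a, ‖f a‖ * ‖g a‖ ∂μ ≤ √(∫ a, ‖f a‖ ^ 2 ∂μ) * √(∫ a, ‖g a‖ ^ 2 ∂μ) := by
  have key := integral_mul_norm_le_Lp_mul_Lq (μ := μ) (f := fun a => ‖f a‖)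
    (g := fun a => ‖g a‖) Real.HolderConjugate.two_two (by simpa using hf.norm)
    (by simpa using hg.norm)
  simpa [Real.sqrt_eq_rpow] using key

/-- A function whose derivative grows at most linearly is locally Lipschitz with a constant growing
at most linearly. -/
lemma norm_sub_le_of_norm_fderiv_le_linear {E F : Type*} [NormedAddCommGroup E] [NormedSpace ℝ E]
    [NormedAddCommGroup F] [NormedSpace ℝ F] {f : E → F} {a b : ℝ} (hb : 0 ≤ b)
    (hf : ∀ x, DifferentiableAt ℝ f x ∧ ‖fderiv ℝ f x‖ ≤ a + b * ‖x‖) (x y : E) :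
    ‖f x - f y‖ ≤ (a + b * (‖x‖ + ‖y‖)) * ‖x - y‖ := by
  refine (convex_closedBall (0 : E) (‖x‖ + ‖y‖)).norm_image_sub_le_of_norm_fderiv_le (𝕜 := ℝ)
    (fun z _ => (hf z).1) (fun z hz => (hf z).2.trans ?_) ?_ ?_
  · have hz' : ‖z‖ ≤ ‖x‖ + ‖y‖ := by simpa using hz
    gcongr
  · simp
  · simp

lemma MemP2.memLp_id {d : ℕ} {μ : Measure (EuclideanSpace ℝ (Fin d))} (hμ : MemP2 μ) :
    MemLp id 2 μ :=
  (memLp_two_iff_integrable_sq_norm aestronglyMeasurable_id).2 hμ.2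

lemma MemP2.mix {d : ℕ} {ν₁ ν₂ : Measure (EuclideanSpace ℝ (Fin d))} (h₁ : MemP2 ν₁)
    (h₂ : MemP2 ν₂) {θ : ℝ} (hθ : θ ∈ Set.Icc (0 : ℝ) 1) : MemP2 (mix θ ν₁ ν₂) := by
  have := h₁.1
  have := h₂.1
  refine ⟨⟨?_⟩, ?_⟩
  · simp only [_root_.mix, Measure.add_apply, Measure.smul_apply, measure_univ, smul_eq_mul,
      mul_one]
    rw [← ENNReal.ofReal_add hθ.1 (sub_nonneg.2 hθ.2)]
    simp
  · exact (h₁.2.smul_measure ENNReal.ofReal_ne_top).add_measure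
      (h₂.2.smul_measure ENNReal.ofReal_ne_top)

section Coupling

variable {d : ℕ} {μ μ' : Measure (EuclideanSpace ℝ (Fin d))}
  {π : Measure (EuclideanSpace ℝ (Fin d) × EuclideanSpace ℝ (Fin d))}

lemma IsCoupling.measurePreserving_fst (hπ : IsCoupling π μ μ') :
    MeasurePreserving Prod.fst π μ :=
  ⟨measurable_fst, hπ.2.1⟩

lemma IsCoupling.measurePreserving_snd (hπ : IsCoupling π μ μ') :
    MeasurePreserving Prod.snd π μ' :=
  ⟨measurable_snd, hπ.2.2⟩

lemma IsCoupling.integral_fst {G : Type*} [NormedAddCommGroup G] [NormedSpace ℝ G]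
    (hπ : IsCoupling π μ μ') {g : EuclideanSpace ℝ (Fin d) → G} (hg : AEStronglyMeasurable g μ) :
    ∫ x, g x ∂μ = ∫ p, g p.1 ∂π := by
  rw [← hπ.2.1] at hg ⊢
  exact integral_map measurable_fst.aemeasurable hg

lemma IsCoupling.integral_snd {G : Type*} [NormedAddCommGroup G] [NormedSpace ℝ G]
    (hπ : IsCoupling π μ μ') {g : EuclideanSpace ℝ (Fin d) → G} (hg : AEStronglyMeasurable g μ') :
    ∫ x, g x ∂μ' = ∫ p, g p.2 ∂π := by
  rw [← hπ.2.2] at hg ⊢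
  exact integral_map measurable_snd.aemeasurable hg

/-- The integrals of a function with derivative of at most linear growth against two measures
differ by at most the transport cost of any coupling. -/
lemma IsCoupling.norm_integral_sub_integral_le {F : Type*} [NormedAddCommGroup F] [NormedSpace ℝ F]
    (hπ : IsCoupling π μ μ') (hμ : MemP2 μ) (hμ' : MemP2 μ')
    {f : EuclideanSpace ℝ (Fin d) → F} {a b : ℝ} (hb : 0 ≤ b)
    (hf : ∀ x, DifferentiableAt ℝ f x ∧ ‖fderiv ℝ f x‖ ≤ a + b * ‖x‖)
    (hfμ : Integrable f μ) (hfμ' : Integrable f μ') :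
    ‖(∫ x, f x ∂μ) - ∫ x, f x ∂μ'‖ ≤
      a * (∫ p, ‖p.1 - p.2‖ ∂π) +
        b * (√(∫ x, ‖x‖ ^ 2 ∂μ) + √(∫ x, ‖x‖ ^ 2 ∂μ')) * √(∫ p, ‖p.1 - p.2‖ ^ 2 ∂π) := by
  have := hπ.1
  have h₁ : MemLp Prod.fst 2 π := hμ.memLp_id.comp_measurePreserving hπ.measurePreserving_fst
  have h₂ : MemLp Prod.snd 2 π := hμ'.memLp_id.comp_measurePreserving hπ.measurePreserving_snd
  have h₁₂ : MemLp (fun p : EuclideanSpace ℝ (Fin d) × EuclideanSpace ℝ (Fin d) => p.1 - p.2) 2 π :=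
    h₁.sub h₂
  have hi : Integrable (fun p : EuclideanSpace ℝ (Fin d) × EuclideanSpace ℝ (Fin d) =>
      ‖p.1 - p.2‖) π := (h₁₂.integrable one_le_two).norm
  have hi₁ : Integrable (fun p : EuclideanSpace ℝ (Fin d) × EuclideanSpace ℝ (Fin d) =>
      ‖p.1‖ * ‖p.1 - p.2‖) π := h₁.norm.integrable_mul h₁₂.norm
  have hi₂ : Integrable (fun p : EuclideanSpace ℝ (Fin d) × EuclideanSpace ℝ (Fin d) =>
      ‖p.2‖ * ‖p.1 - p.2‖) π := h₂.norm.integrable_mul h₁₂.norm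
  have hf₁ : Integrable (fun p : EuclideanSpace ℝ (Fin d) × EuclideanSpace ℝ (Fin d) => f p.1) π :=
    hπ.measurePreserving_fst.integrable_comp_of_integrable hfμ
  have hf₂ : Integrable (fun p : EuclideanSpace ℝ (Fin d) × EuclideanSpace ℝ (Fin d) => f p.2) π :=
    hπ.measurePreserving_snd.integrable_comp_of_integrable hfμ'
  have hcs₁ := integral_norm_mul_norm_le_sqrt_mul_sqrt h₁ h₁₂
  have hcs₂ := integral_norm_mul_norm_le_sqrt_mul_sqrt h₂ h₁₂
  rw [hπ.integral_fst hfμ.aestronglyMeasurable, hπ.integral_snd hfμ'.aestronglyMeasurable,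
    hπ.integral_fst hμ.2.aestronglyMeasurable, hπ.integral_snd hμ'.2.aestronglyMeasurable,
    ← integral_sub hf₁ hf₂]
  calc ‖∫ p, f p.1 - f p.2 ∂π‖
      ≤ ∫ p, a * ‖p.1 - p.2‖ + b * (‖p.1‖ * ‖p.1 - p.2‖ + ‖p.2‖ * ‖p.1 - p.2‖) ∂π := by
        refine norm_integral_le_of_norm_le ((hi.const_mul a).add ((hi₁.add hi₂).const_mul b))
          (.of_forall fun p => ?_)
        refine (norm_sub_le_of_norm_fderiv_le_linear hb hf p.1 p.2).trans_eq ?_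
        ring
    _ = a * (∫ p, ‖p.1 - p.2‖ ∂π) +
          b * ((∫ p, ‖p.1‖ * ‖p.1 - p.2‖ ∂π) + ∫ p, ‖p.2‖ * ‖p.1 - p.2‖ ∂π) := by
        rw [← integral_add hi₁ hi₂, ← integral_const_mul, ← integral_const_mul]
        exact integral_add (hi.const_mul a) ((hi₁.add hi₂).const_mul b)
    _ ≤ _ := by
        rw [mul_assoc b, add_mul]
        gcongr

end Coupling

/-- inequality (12.2) of the appendix: a function `h` on the Wasserstein
space whose linear functional derivative `δh` has an at most linearly growing gradient
satisfies, for every coupling `π` of `μ` and `μ'`,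
`‖h μ − h μ'‖ ≤ l₁ ∫‖x−x'‖ dπ + l₂ (‖μ‖₂ + ‖μ'‖₂) (∫‖x−x'‖² dπ)^{1/2}`. -/
theorem stmt_5 (d l : ℕ) (hd : 1 ≤ d) (hl : 1 ≤ l) (l₁ l₂ : ℝ) (hl₁ : 0 ≤ l₁) (hl₂ : 0 ≤ l₂)
    (h : Measure (EuclideanSpace ℝ (Fin d)) → EuclideanSpace ℝ (Fin l))
    (δh : Measure (EuclideanSpace ℝ (Fin d)) → EuclideanSpace ℝ (Fin d) →
      EuclideanSpace ℝ (Fin l))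
    (hderiv : ∀ μ, MemP2 μ → ∀ x : EuclideanSpace ℝ (Fin d),
      DifferentiableAt ℝ (δh μ) x ∧ ‖fderiv ℝ (δh μ) x‖ ≤ l₁ + l₂ * ‖x‖)
    (hlfd : ∀ ν₁ ν₂, MemP2 ν₁ → MemP2 ν₂ →
      (∀ θ ∈ Set.Icc (0:ℝ) 1,
        Integrable (δh (mix θ ν₁ ν₂)) ν₁ ∧ Integrable (δh (mix θ ν₁ ν₂)) ν₂) ∧
      IntervalIntegrable
        (fun θ => (∫ x, δh (mix θ ν₁ ν₂) x ∂ν₁) - ∫ x, δh (mix θ ν₁ ν₂) x ∂ν₂)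
        MeasureTheory.volume 0 1 ∧
      h ν₁ - h ν₂ =
        ∫ θ in (0:ℝ)..1,
          ((∫ x, δh (mix θ ν₁ ν₂) x ∂ν₁) - ∫ x, δh (mix θ ν₁ ν₂) x ∂ν₂)) :
    ∀ μ μ', MemP2 μ → MemP2 μ' →
      ∀ π, IsCoupling π μ μ' →
        ‖h μ - h μ'‖ ≤
          l₁ * (∫ p, ‖p.1 - p.2‖ ∂π) +
          l₂ * (Real.sqrt (∫ x, ‖x‖ ^ 2 ∂μ) + Real.sqrt (∫ x, ‖x‖ ^ 2 ∂μ')) *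
            Real.sqrt (∫ p, ‖p.1 - p.2‖ ^ 2 ∂π) := by
  intro μ μ' hμ hμ' π hπ
  obtain ⟨hint, -, heq⟩ := hlfd μ μ' hμ hμ'
  rw [heq]
  refine (intervalIntegral.norm_integral_le_of_norm_le_const fun θ hθ => ?_).trans_eq
    (by rw [sub_zero, abs_one, mul_one])
  rw [Set.uIoc_of_le zero_le_one] at hθ
  have hθ' := Set.Ioc_subset_Icc_self hθ
  exact hπ.norm_integral_sub_integral_le hμ hμ' hl₂ (hderiv _ (hμ.mix hμ' hθ'))
    (hint θ hθ').1 (hint θ hθ').2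
end

section
/- Let d ≥ 1 and let P₁ denote the set of Borel probability measures on ℝ^d with finite first moment; write ‖ν‖₁ := ∫‖y‖dν(y), and call π a coupling of ν and ν' if π is a Borel probability measure on ℝ^d × ℝ^d with marginals ν and ν'. Let constants C > 0 and 0 < L_p ≤ L̄_p be given, and let B : ℝ^d × P₁ × ℝ^d → ℝ^d, Ψ : ℝ^d × P₁ × ℝ^d → ℝ^d, Φ : ℝ^d × P₁ × ℝ^d × ℝ^d → ℝ^d, p : ℝ^d × P₁ → ℝ^d satisfy: (i) growth: ‖B(x,ν,z)‖ ≤ C(1+‖x‖+‖ν‖₁+‖z‖), ‖Ψ(x,ν,z)‖ ≤ C(1+‖x‖+‖ν‖₁+‖z‖), ‖Φ(x̃,ν,x,z̃)‖ ≤ C(1+‖x̃‖+‖ν‖₁+‖x‖+‖z̃‖), ‖p(x,ν)‖ ≤ L̄_p(1+‖x‖+‖ν‖₁); (ii) Lipschitz continuity on the cone: whenever ‖z‖ ≤ 2L̄_p(1+‖x‖+‖ν‖₁) and ‖z'‖ ≤ 2L̄_p(1+‖x'‖+‖ν'‖₁), and π is any coupling of ν and ν', then ‖B(x,ν,z)−B(x',ν',z')‖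 ≤ C(‖x−x'‖+∫‖y−y'‖dπ+‖z−z'‖), and the analogous Lipschitz bounds with constant C hold for Ψ and (in all four arguments) for Φ; (iii) ‖p(x,ν)−p(x',ν')‖ ≤ L_p(‖x−x'‖+∫‖y−y'‖dπ) for every coupling π. Then there exists ε > 0, depending only on C, L_p, L̄_p, such that for all 0 ≤ t ≤ T̃ with T̃ − t ≤ ε there exist a jointly continuous field γ : [t,T̃] × ℝ^d × P₁ → ℝ^d with ‖γ(s,x,m)‖ ≤ 2L̄_p(1+‖x‖+‖m‖₁) for all (s,x,m), and, for every (s,m) ∈ [t,T̃] × P₁, a jointly continuous flow X^{s,m} : [s,T̃] × ℝ^d → ℝ^d, such that for all s ≤ τ ≤ T̃ and all x ∈ ℝ^d: X^{s,m}_τ(x) = x + ∫_s^τ B(X^{s,m}_r(x), (X^{s,m}_r)_#m, γ(r, X^{s,m}_r(x), (X^{s,m}_r)_#m)) dr, and γ(s,x,m) = p(X^{s,m}_{T̃}(x), (X^{s,m}_{T̃})_#m) + ∫_s^{T̃} [ ∫ Φ(X^{s,m}_τ(x̃), (X^{s,m}_τ)_#m, X^{s,m}_τ(x), γ(τ, X^{s,m}_τ(x̃),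 (X^{s,m}_τ)_#m)) dm(x̃) + Ψ(X^{s,m}_τ(x), (X^{s,m}_τ)_#m, γ(τ, X^{s,m}_τ(x), (X^{s,m}_τ)_#m)) ] dτ, where (X_r)_#m denotes the pushforward of m by X_r. In particular, Z^{t,m}_s(x) := γ(s, X^{t,m}_s(x), (X^{t,m}_s)_#m) together with X^{t,m} solves the forward–backward system on [t,T̃] and satisfies the cone condition ‖Z^{t,m}_s(x)‖ ≤ 2L̄_p(1 + ‖X^{t,m}_s(x)‖ + ∫‖X^{t,m}_s(y)‖dm(y)). -/
open MeasureTheory Set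

/-- Probability measures on `ℝ^d` with finite first moment. -/
def MemP1 {d : ℕ} (μ : Measure (EuclideanSpace ℝ (Fin d))) : Prop :=
  IsProbabilityMeasure μ ∧ Integrable (fun x => ‖x‖) μ

/-- The first moment `‖ν‖₁ = ∫ ‖y‖ dν(y)`. -/
noncomputable def mnorm1 {d : ℕ} (ν : Measure (EuclideanSpace ℝ (Fin d))) : ℝ :=
  ∫ y, ‖y‖ ∂ν

/-- The `1`-Wasserstein distance, as an infimum over couplings. -/
noncomputable def W1 {d : ℕ} (μ ν : Measure (EuclideanSpace ℝ (Fin d))) : ℝ :=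
  sInf {r : ℝ | ∃ π, IsCoupling π μ ν ∧ r = ∫ p, ‖p.1 - p.2‖ ∂π}

section

variable {d : ℕ}

local notation "𝔼" => EuclideanSpace ℝ (Fin d)

theorem MemP1.integrable_of_growth {m : Measure 𝔼} (hm : MemP1 m) {f : 𝔼 → 𝔼} (hf : Continuous f)
    {Q : ℝ} (hQ : ∀ x, ‖f x‖ ≤ Q * (1 + ‖x‖)) : Integrable f m := by
  have := hm.1
  exact (((integrable_const 1).add hm.2).const_mul Q).mono' hf.aestronglyMeasurable
    (Filter.Eventually.of_forall hQ)

theorem mnorm1_nonneg (m : Measure 𝔼) : 0 ≤ mnorm1 m :=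
  integral_nonneg fun _ => norm_nonneg _

theorem mnorm1_map (m : Measure 𝔼) {X : 𝔼 → 𝔼} (hX : Continuous X) :
    mnorm1 (m.map X) = ∫ y, ‖X y‖ ∂m :=
  integral_map hX.measurable.aemeasurable continuous_norm.aestronglyMeasurable

theorem MemP1.map {m : Measure 𝔼} (hm : MemP1 m) {X : 𝔼 → 𝔼} (hX : Continuous X)
    (hi : Integrable X m) : MemP1 (m.map X) := by
  have := hm.1
  refine ⟨Measure.isProbabilityMeasure_map hX.measurable.aemeasurable, ?_⟩
  rw [integrable_map_measure continuous_norm.aestronglyMeasurable hX.measurable.aemeasurable]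
  exact hi.norm

theorem isCoupling_map {Ω : Type*} [MeasurableSpace Ω] (P : Measure Ω) [IsProbabilityMeasure P]
    {f f' : Ω → 𝔼} (hf : Measurable f) (hf' : Measurable f') :
    IsCoupling (P.map fun ω => (f ω, f' ω)) (P.map f) (P.map f') := by
  refine ⟨Measure.isProbabilityMeasure_map (hf.prodMk hf').aemeasurable, ?_, ?_⟩
  · rw [Measure.map_map measurable_fst (hf.prodMk hf')]; rfl
  · rw [Measure.map_map measurable_snd (hf.prodMk hf')]; rfl

theorem integral_isCoupling_map {Ω : Type*} [MeasurableSpace Ω] (P : Measure Ω)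
    {f f' : Ω → 𝔼} (hf : Measurable f) (hf' : Measurable f') :
    ∫ q, ‖q.1 - q.2‖ ∂(P.map fun ω => (f ω, f' ω)) = ∫ ω, ‖f ω - f' ω‖ ∂P :=
  integral_map (hf.prodMk hf').aemeasurable
    (by fun_prop : Continuous fun q : 𝔼 × 𝔼 => ‖q.1 - q.2‖).aestronglyMeasurable

theorem exists_isCoupling_self {m : Measure 𝔼} (hm : MemP1 m) :
    ∃ π, IsCoupling π m m ∧ ∫ q, ‖q.1 - q.2‖ ∂π = 0 := by
  have := hm.1
  refine ⟨m.map fun y => (y, y), ?_, ?_⟩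
  · have := isCoupling_map m (f := fun y : 𝔼 => y) (f' := fun y => y) measurable_id' measurable_id'
    simpa using this
  · rw [integral_isCoupling_map m measurable_id' measurable_id']; simp

theorem exists_isCoupling_lt_of_W1_lt {m m' : Measure 𝔼} (hm : MemP1 m) (hm' : MemP1 m') {δ : ℝ}
    (h : W1 m m' < δ) : ∃ π, IsCoupling π m m' ∧ ∫ q, ‖q.1 - q.2‖ ∂π < δ := by
  have := hm.1
  have := hm'.1
  have hprod : IsCoupling (m.prod m') m m' := ⟨inferInstance, by simp, by simp⟩
  have hne : {r : ℝ | ∃ π, IsCoupling π m m' ∧ r = ∫ q, ‖q.1 - q.2‖ ∂π}.Nonempty :=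
    ⟨_, _, hprod, rfl⟩
  obtain ⟨r, ⟨π, hπ, rfl⟩, hr⟩ := exists_lt_of_csInf_lt hne h
  exact ⟨π, hπ, hr⟩

theorem continuousOn_of_norm_sub_le {f : ℝ → 𝔼} {S : Set ℝ} {L : ℝ}
    (h : ∀ u ∈ S, ∀ v ∈ S, ‖f u - f v‖ ≤ L * |u - v|) : ContinuousOn f S := by
  refine (LipschitzOnWith.of_dist_le_mul (K := L.toNNReal) fun u hu v hv => ?_).continuousOn
  rw [dist_eq_norm, Real.dist_eq]
  exact (h u hu v hv).trans
    (mul_le_mul_of_nonneg_right (Real.le_coe_toNNReal L) (abs_nonneg _))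

/-- Growth and Lipschitz hypotheses on the coefficients of the forward–backward system. -/
structure CoeffBounds (C Lp Lpb : ℝ) (B Ψ : 𝔼 → Measure 𝔼 → 𝔼 → 𝔼)
    (Φ : 𝔼 → Measure 𝔼 → 𝔼 → 𝔼 → 𝔼) (p : 𝔼 → Measure 𝔼 → 𝔼) : Prop where
  C_pos : 0 < C
  Lp_pos : 0 < Lp
  Lp_le : Lp ≤ Lpb
  growth_B : ∀ x ν z, MemP1 ν → ‖B x ν z‖ ≤ C * (1 + ‖x‖ + mnorm1 ν + ‖z‖)
  growth_Ψ : ∀ x ν z, MemP1 ν → ‖Ψ x ν z‖ ≤ C * (1 + ‖x‖ + mnorm1 ν + ‖z‖)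
  growth_Φ : ∀ xt ν x zt, MemP1 ν → ‖Φ xt ν x zt‖ ≤ C * (1 + ‖xt‖ + mnorm1 ν + ‖x‖ + ‖zt‖)
  growth_p : ∀ x ν, MemP1 ν → ‖p x ν‖ ≤ Lpb * (1 + ‖x‖ + mnorm1 ν)
  lip_B : ∀ x x' ν ν' z z' π, MemP1 ν → MemP1 ν' → IsCoupling π ν ν' →
    ‖z‖ ≤ 2 * Lpb * (1 + ‖x‖ + mnorm1 ν) → ‖z'‖ ≤ 2 * Lpb * (1 + ‖x'‖ + mnorm1 ν') →
    ‖B x ν z - B x' ν' z'‖ ≤ C * (‖x - x'‖ + (∫ q, ‖q.1 - q.2‖ ∂π) + ‖z - z'‖)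
  lip_Ψ : ∀ x x' ν ν' z z' π, MemP1 ν → MemP1 ν' → IsCoupling π ν ν' →
    ‖z‖ ≤ 2 * Lpb * (1 + ‖x‖ + mnorm1 ν) → ‖z'‖ ≤ 2 * Lpb * (1 + ‖x'‖ + mnorm1 ν') →
    ‖Ψ x ν z - Ψ x' ν' z'‖ ≤ C * (‖x - x'‖ + (∫ q, ‖q.1 - q.2‖ ∂π) + ‖z - z'‖)
  lip_Φ : ∀ xt xt' ν ν' x x' zt zt' π, MemP1 ν → MemP1 ν' → IsCoupling π ν ν' →
    ‖zt‖ ≤ 2 * Lpb * (1 + ‖xt‖ + mnorm1 ν) → ‖zt'‖ ≤ 2 * Lpb * (1 + ‖xt'‖ + mnorm1 ν') →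
    ‖Φ xt ν x zt - Φ xt' ν' x' zt'‖ ≤
      C * (‖xt - xt'‖ + (∫ q, ‖q.1 - q.2‖ ∂π) + ‖x - x'‖ + ‖zt - zt'‖)
  lip_p : ∀ x x' ν ν' π, MemP1 ν → MemP1 ν' → IsCoupling π ν ν' →
    ‖p x ν - p x' ν'‖ ≤ Lp * (‖x - x'‖ + ∫ q, ‖q.1 - q.2‖ ∂π)

/-- A pair of continuous maps of linear growth whose second entry lies in the cone. -/
structure ConeAdmissible (Lpb : ℝ) (m : Measure 𝔼) (X Z : 𝔼 → 𝔼) : Prop where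
  continuous_fst : Continuous X
  continuous_snd : Continuous Z
  integrable_fst : Integrable X m
  integrable_snd : Integrable Z m
  cone : ∀ x, ‖Z x‖ ≤ 2 * Lpb * (1 + ‖X x‖ + ∫ y, ‖X y‖ ∂m)

/-- The drift of the forward equation in Lagrangian coordinates. -/
noncomputable def drift (B : 𝔼 → Measure 𝔼 → 𝔼 → 𝔼) (m : Measure 𝔼) (X Z : 𝔼 → 𝔼) (x : 𝔼) : 𝔼 :=
  B (X x) (m.map X) (Z x)

/-- The driver of the backward equation in Lagrangian coordinates. -/
noncomputable def driver (Ψ : 𝔼 → Measure 𝔼 → 𝔼 → 𝔼) (Φ : 𝔼 → Measure 𝔼 → 𝔼 → 𝔼 → 𝔼)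
    (m : Measure 𝔼) (X Z : 𝔼 → 𝔼) (x : 𝔼) : 𝔼 :=
  (∫ xt, Φ (X xt) (m.map X) (X x) (Z xt) ∂m) + Ψ (X x) (m.map X) (Z x)

variable {C Lp Lpb : ℝ}
  {B Ψ : EuclideanSpace ℝ (Fin d) → Measure (EuclideanSpace ℝ (Fin d)) →
    EuclideanSpace ℝ (Fin d) → EuclideanSpace ℝ (Fin d)}
  {Φ : EuclideanSpace ℝ (Fin d) → Measure (EuclideanSpace ℝ (Fin d)) →
    EuclideanSpace ℝ (Fin d) → EuclideanSpace ℝ (Fin d) → EuclideanSpace ℝ (Fin d)}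
  {p : EuclideanSpace ℝ (Fin d) → Measure (EuclideanSpace ℝ (Fin d)) → EuclideanSpace ℝ (Fin d)}

theorem ConeAdmissible.memP1_map {m : Measure 𝔼} {X Z : 𝔼 → 𝔼} (h : ConeAdmissible Lpb m X Z)
    (hm : MemP1 m) : MemP1 (m.map X) :=
  hm.map h.continuous_fst h.integrable_fst

theorem ConeAdmissible.cone_map {m : Measure 𝔼} {X Z : 𝔼 → 𝔼} (h : ConeAdmissible Lpb m X Z)
    (x : 𝔼) : ‖Z x‖ ≤ 2 * Lpb * (1 + ‖X x‖ + mnorm1 (m.map X)) := by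
  rw [mnorm1_map m h.continuous_fst]
  exact h.cone x

theorem CoeffBounds.continuous_Φ (hc : CoeffBounds C Lp Lpb B Ψ Φ p) {m : Measure 𝔼}
    (hm : MemP1 m) {X Z : 𝔼 → 𝔼} (h : ConeAdmissible Lpb m X Z) (x : 𝔼) :
    Continuous fun xt => Φ (X xt) (m.map X) x (Z xt) := by
  obtain ⟨π, hπ, hπ0⟩ := exists_isCoupling_self (h.memP1_map hm)
  refine continuous_iff_continuousAt.2 fun b => tendsto_iff_norm_sub_tendsto_zero.2 ?_
  refine squeeze_zero (fun _ => norm_nonneg _) (fun a => hc.lip_Φ _ _ _ _ x x _ _ π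
    (h.memP1_map hm) (h.memP1_map hm) hπ (h.cone_map a) (h.cone_map b)) ?_
  rw [hπ0]
  have hX := h.continuous_fst
  have hZ := h.continuous_snd
  have : Continuous fun a => C * (‖X a - X b‖ + 0 + ‖x - x‖ + ‖Z a - Z b‖) := by fun_prop
  simpa using this.tendsto b

theorem CoeffBounds.integrable_Φ (hc : CoeffBounds C Lp Lpb B Ψ Φ p) {m : Measure 𝔼}
    (hm : MemP1 m) {X Z : 𝔼 → 𝔼} (h : ConeAdmissible Lpb m X Z) (x : 𝔼) :
    Integrable (fun xt => Φ (X xt) (m.map X) x (Z xt)) m := by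
  have := hm.1
  have hX := h.integrable_fst.norm
  have hZ := h.integrable_snd.norm
  refine Integrable.mono' (g := fun xt => C * (1 + ‖X xt‖ + mnorm1 (m.map X) + ‖x‖ + ‖Z xt‖))
    (by fun_prop) (hc.continuous_Φ hm h x).aestronglyMeasurable
    (Filter.Eventually.of_forall fun xt => hc.growth_Φ _ _ _ _ (h.memP1_map hm))

theorem CoeffBounds.norm_drift_sub_driver_sub_le (hc : CoeffBounds C Lp Lpb B Ψ Φ p)
    {m m' : Measure 𝔼} (hm : MemP1 m) (hm' : MemP1 m') {X Z X' Z' : 𝔼 → 𝔼}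
    (h : ConeAdmissible Lpb m X Z) (h' : ConeAdmissible Lpb m' X' Z')
    {Ω : Type*} [MeasurableSpace Ω] {P : Measure Ω} [IsProbabilityMeasure P] {Y Y' : Ω → 𝔼}
    (hY : Measurable Y) (hY' : Measurable Y') (hYm : P.map Y = m) (hYm' : P.map Y' = m')
    {g : Ω → ℝ} (hg : Integrable g P) (hgX : ∀ ω, ‖X (Y ω) - X' (Y' ω)‖ ≤ g ω)
    (hgZ : ∀ ω, ‖Z (Y ω) - Z' (Y' ω)‖ ≤ g ω) {x x' : 𝔼} {g₀ : ℝ}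
    (hX : ‖X x - X' x'‖ ≤ g₀) (hZ : ‖Z x - Z' x'‖ ≤ g₀) :
    ‖drift B m X Z x - drift B m' X' Z' x'‖ ≤ C * (2 * g₀ + ∫ ω, g ω ∂P) ∧
    ‖driver Ψ Φ m X Z x - driver Ψ Φ m' X' Z' x'‖ ≤ C * (3 * g₀ + 4 * ∫ ω, g ω ∂P) := by
  have hC := hc.C_pos
  have hXm := h.continuous_fst.measurable
  have hXm' := h'.continuous_fst.measurable
  set G := ∫ ω, g ω ∂P with hG
  obtain ⟨π, hπ, hπG⟩ : ∃ π, IsCoupling π (m.map X) (m'.map X') ∧ ∫ q, ‖q.1 - q.2‖ ∂π ≤ G := by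
    refine ⟨P.map fun ω => (X (Y ω), X' (Y' ω)), ?_, ?_⟩
    · have := isCoupling_map P (hXm.comp hY) (hXm'.comp hY')
      rwa [← Measure.map_map hXm hY, ← Measure.map_map hXm' hY', hYm, hYm'] at this
    · have := integral_isCoupling_map P (hXm.comp hY) (hXm'.comp hY')
      simp only [Function.comp_apply] at this
      rw [this]
      exact integral_mono_of_nonneg (Filter.Eventually.of_forall fun _ => norm_nonneg _) hg
        (Filter.Eventually.of_forall hgX)
  have hM := h.memP1_map hm
  have hM' := h'.memP1_map hm'
  have hΨ := hc.lip_Ψ (X x) (X' x') _ _ (Z x) (Z' x') π hM hM' hπ (h.cone_map x) (h'.cone_map x')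
  have hB := hc.lip_B (X x) (X' x') _ _ (Z x) (Z' x') π hM hM' hπ (h.cone_map x) (h'.cone_map x')
  have hle : C * (‖X x - X' x'‖ + (∫ q, ‖q.1 - q.2‖ ∂π) + ‖Z x - Z' x'‖) ≤ C * (2 * g₀ + G) :=
    mul_le_mul_of_nonneg_left (by linarith) hC.le
  refine ⟨hB.trans hle, ?_⟩
  have hΦ : ‖(∫ xt, Φ (X xt) (m.map X) (X x) (Z xt) ∂m) -
      ∫ xt, Φ (X' xt) (m'.map X') (X' x') (Z' xt) ∂m'‖ ≤ C * (g₀ + 3 * G) := by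
    have e1 : (∫ xt, Φ (X xt) (m.map X) (X x) (Z xt) ∂m) =
        ∫ ω, Φ (X (Y ω)) (m.map X) (X x) (Z (Y ω)) ∂P := by
      have := integral_map (μ := P) hY.aemeasurable
        (hc.continuous_Φ hm h (X x)).aestronglyMeasurable
      rwa [hYm] at this
    have e2 : (∫ xt, Φ (X' xt) (m'.map X') (X' x') (Z' xt) ∂m') =
        ∫ ω, Φ (X' (Y' ω)) (m'.map X') (X' x') (Z' (Y' ω)) ∂P := by
      have := integral_map (μ := P) hY'.aemeasurable
        (hc.continuous_Φ hm' h' (X' x')).aestronglyMeasurable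
      rwa [hYm'] at this
    have i1 : Integrable (fun ω => Φ (X (Y ω)) (m.map X) (X x) (Z (Y ω))) P := by
      have := hc.integrable_Φ hm h (X x)
      rw [← hYm] at this
      have := this.comp_measurable hY
      rwa [hYm] at this
    have i2 : Integrable (fun ω => Φ (X' (Y' ω)) (m'.map X') (X' x') (Z' (Y' ω))) P := by
      have := hc.integrable_Φ hm' h' (X' x')
      rw [← hYm'] at this
      have := this.comp_measurable hY'
      rwa [hYm'] at this
    rw [e1, e2, ← integral_sub i1 i2]
    calc _ ≤ ∫ ω, C * (2 * g ω + (G + g₀)) ∂P := by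
          refine norm_integral_le_of_norm_le (by fun_prop) (Filter.Eventually.of_forall fun ω => ?_)
          refine (hc.lip_Φ _ _ _ _ _ _ _ _ π hM hM' hπ (h.cone_map _) (h'.cone_map _)).trans ?_
          exact mul_le_mul_of_nonneg_left (by linarith [hgX ω, hgZ ω]) hC.le
      _ = C * (g₀ + 3 * G) := by
          rw [integral_const_mul, integral_add (hg.const_mul 2) (integrable_const _),
            integral_const_mul, integral_const, probReal_univ, one_smul, ← hG]
          ring
  unfold driver
  rw [add_sub_add_comm]
  refine (norm_add_le _ _).trans ?_
  linarith [hΨ.trans hle]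

/-- A pair of time-dependent maps, Lipschitz in time on `[s, T]`, which is cone-admissible at every
time. -/
structure AdmissiblePath (Lpb Q s T : ℝ) (m : Measure 𝔼) (X Z : ℝ → 𝔼 → 𝔼) : Prop where
  continuous_fst : ∀ r ∈ Icc s T, Continuous (X r)
  continuous_snd : ∀ r ∈ Icc s T, Continuous (Z r)
  growth_fst : ∀ r ∈ Icc s T, ∀ x, ‖X r x‖ ≤ Q * (1 + ‖x‖)
  growth_snd : ∀ r ∈ Icc s T, ∀ x, ‖Z r x‖ ≤ Q * (1 + ‖x‖)
  time_fst : ∀ r ∈ Icc s T, ∀ r' ∈ Icc s T, ∀ x, ‖X r x - X r' x‖ ≤ Q * (1 + ‖x‖) * |r - r'|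
  time_snd : ∀ r ∈ Icc s T, ∀ r' ∈ Icc s T, ∀ x, ‖Z r x - Z r' x‖ ≤ Q * (1 + ‖x‖) * |r - r'|
  cone : ∀ r ∈ Icc s T, ∀ x, ‖Z r x‖ ≤ 2 * Lpb * (1 + ‖X r x‖ + ∫ y, ‖X r y‖ ∂m)

theorem AdmissiblePath.coneAdmissible {Q s T : ℝ} {m : Measure 𝔼} {X Z : ℝ → 𝔼 → 𝔼}
    (h : AdmissiblePath Lpb Q s T m X Z) (hm : MemP1 m) {r : ℝ} (hr : r ∈ Icc s T) :
    ConeAdmissible Lpb m (X r) (Z r) where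
  continuous_fst := h.continuous_fst r hr
  continuous_snd := h.continuous_snd r hr
  integrable_fst := hm.integrable_of_growth (h.continuous_fst r hr) (h.growth_fst r hr)
  integrable_snd := hm.integrable_of_growth (h.continuous_snd r hr) (h.growth_snd r hr)
  cone := h.cone r hr

theorem AdmissiblePath.continuousOn_drift_driver (hc : CoeffBounds C Lp Lpb B Ψ Φ p)
    {Q s T : ℝ} {m : Measure 𝔼} {X Z : ℝ → 𝔼 → 𝔼} (hm : MemP1 m)
    (h : AdmissiblePath Lpb Q s T m X Z) (x : 𝔼) :
    ContinuousOn (fun u => drift B m (X u) (Z u) x) (Icc s T) ∧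
    ContinuousOn (fun u => driver Ψ Φ m (X u) (Z u) x) (Icc s T) := by
  have := hm.1
  have key : ∀ u ∈ Icc s T, ∀ v ∈ Icc s T, _ := fun u hu v hv =>
    hc.norm_drift_sub_driver_sub_le hm hm (h.coneAdmissible hm hu) (h.coneAdmissible hm hv)
      (P := m) measurable_id measurable_id Measure.map_id Measure.map_id
      (g := fun y => Q * (1 + ‖y‖) * |u - v|)
      ((((integrable_const 1).add hm.2).const_mul Q).mul_const _)
      (fun y => h.time_fst u hu v hv y) (fun y => h.time_snd u hu v hv y)
      (h.time_fst u hu v hv x) (h.time_snd u hu v hv x)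
  constructor
  · refine continuousOn_of_norm_sub_le
      (L := C * (2 * (Q * (1 + ‖x‖)) + ∫ y, Q * (1 + ‖y‖) ∂m)) fun u hu v hv => ?_
    refine (key u hu v hv).1.trans_eq ?_
    rw [integral_mul_const]; ring
  · refine continuousOn_of_norm_sub_le
      (L := C * (3 * (Q * (1 + ‖x‖)) + 4 * ∫ y, Q * (1 + ‖y‖) ∂m)) fun u hu v hv => ?_
    refine (key u hu v hv).2.trans_eq ?_
    rw [integral_mul_const]; ring

theorem norm_intervalIntegral_sub_le {f f' : ℝ → 𝔼} {s T a b K : ℝ} (hf : ContinuousOn f (Icc s T))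
    (hf' : ContinuousOn f' (Icc s T)) (ha : a ∈ Icc s T) (hb : b ∈ Icc s T)
    (h : ∀ u ∈ Icc s T, ‖f u - f' u‖ ≤ K) :
    ‖(∫ u in a..b, f u) - ∫ u in a..b, f' u‖ ≤ (T - s) * K := by
  have hsub := uIcc_subset_Icc ha hb
  rw [← intervalIntegral.integral_sub (hf.mono hsub).intervalIntegrable
    (hf'.mono hsub).intervalIntegrable]
  refine (intervalIntegral.norm_integral_le_of_norm_le_const
    fun u hu => h u (hsub (uIoc_subset_uIcc hu))).trans ?_
  rw [mul_comm]
  refine mul_le_mul_of_nonneg_right ?_ ((norm_nonneg _).trans (h a ha))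
  rw [abs_le]
  constructor <;> linarith [ha.1, ha.2, hb.1, hb.2]

/-- `(X₁, Z₁)` is obtained from `(X, Z)` by one Picard step for the Lagrangian forward–backward
system on `[s, T]` with initial map `ξ`. -/
structure IsPicardStep (B Ψ : 𝔼 → Measure 𝔼 → 𝔼 → 𝔼) (Φ : 𝔼 → Measure 𝔼 → 𝔼 → 𝔼 → 𝔼)
    (p : 𝔼 → Measure 𝔼 → 𝔼) (s T : ℝ) (m : Measure 𝔼) (ξ : 𝔼 → 𝔼) (X Z X₁ Z₁ : ℝ → 𝔼 → 𝔼) :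
    Prop where
  fst : ∀ r ∈ Icc s T, ∀ x, X₁ r x = ξ x + ∫ u in s..r, drift B m (X u) (Z u) x
  snd : ∀ r ∈ Icc s T, ∀ x,
    Z₁ r x = p (X₁ T x) (m.map (X₁ T)) + ∫ u in r..T, driver Ψ Φ m (X u) (Z u) x

/-- Along `[s, T]`, the pair `(X, Z)` at `x` stays within `g` of the pair `(X', Z')` at `x'`. -/
def PathsClose (s T : ℝ) (X Z X' Z' : ℝ → 𝔼 → 𝔼) (x x' : 𝔼) (g : ℝ) : Prop :=
  ∀ u ∈ Icc s T, ‖X u x - X' u x'‖ ≤ g ∧ ‖Z u x - Z' u x'‖ ≤ g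

theorem IsPicardStep.norm_fst_sub_le (hc : CoeffBounds C Lp Lpb B Ψ Φ p) {s T Q Q' : ℝ}
    {m m' : Measure 𝔼} (hm : MemP1 m) (hm' : MemP1 m') {X Z X' Z' : ℝ → 𝔼 → 𝔼}
    (h : AdmissiblePath Lpb Q s T m X Z) (h' : AdmissiblePath Lpb Q' s T m' X' Z')
    {ξ ξ' : 𝔼 → 𝔼} {X₁ Z₁ X₁' Z₁' : ℝ → 𝔼 → 𝔼}
    (k : IsPicardStep B Ψ Φ p s T m ξ X Z X₁ Z₁) (k' : IsPicardStep B Ψ Φ p s T m' ξ' X' Z' X₁' Z₁')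
    {Ω : Type*} [MeasurableSpace Ω] {P : Measure Ω} [IsProbabilityMeasure P] {Y Y' : Ω → 𝔼}
    (hY : Measurable Y) (hY' : Measurable Y') (hYm : P.map Y = m) (hYm' : P.map Y' = m')
    {g : Ω → ℝ} (hg : Integrable g P) (hgc : ∀ ω, PathsClose s T X Z X' Z' (Y ω) (Y' ω) (g ω))
    {x x' : 𝔼} {g₀ : ℝ} (hg₀ : PathsClose s T X Z X' Z' x x' g₀) {r : ℝ} (hr : r ∈ Icc s T) :
    ‖X₁ r x - X₁' r x'‖ ≤ ‖ξ x - ξ' x'‖ + (T - s) * (C * (2 * g₀ + ∫ ω, g ω ∂P)) := by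
  rw [k.fst r hr, k'.fst r hr, add_sub_add_comm]
  refine (norm_add_le _ _).trans (add_le_add_right ?_ _)
  exact norm_intervalIntegral_sub_le (h.continuousOn_drift_driver hc hm x).1
    (h'.continuousOn_drift_driver hc hm' x').1 (left_mem_Icc.2 (hr.1.trans hr.2)) hr fun u hu =>
    (hc.norm_drift_sub_driver_sub_le hm hm' (h.coneAdmissible hm hu) (h'.coneAdmissible hm' hu)
      hY hY' hYm hYm' hg (fun ω => (hgc ω u hu).1) (fun ω => (hgc ω u hu).2) (hg₀ u hu).1
      (hg₀ u hu).2).1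

theorem IsPicardStep.pathsClose (hc : CoeffBounds C Lp Lpb B Ψ Φ p) {s T Q Q' : ℝ} (hsT : s ≤ T)
    (hε : 24 * C * (1 + Lpb) * (T - s) ≤ 1)
    {m m' : Measure 𝔼} (hm : MemP1 m) (hm' : MemP1 m') {X Z X' Z' : ℝ → 𝔼 → 𝔼}
    (h : AdmissiblePath Lpb Q s T m X Z) (h' : AdmissiblePath Lpb Q' s T m' X' Z')
    {ξ ξ' : 𝔼 → 𝔼} {X₁ Z₁ X₁' Z₁' : ℝ → 𝔼 → 𝔼}
    (k : IsPicardStep B Ψ Φ p s T m ξ X Z X₁ Z₁) (k' : IsPicardStep B Ψ Φ p s T m' ξ' X' Z' X₁' Z₁')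
    (hX₁ : Continuous (X₁ T)) (hX₁i : Integrable (X₁ T) m)
    (hX₁' : Continuous (X₁' T)) (hX₁i' : Integrable (X₁' T) m')
    {Ω : Type*} [MeasurableSpace Ω] {P : Measure Ω} [IsProbabilityMeasure P] {Y Y' : Ω → 𝔼}
    (hY : Measurable Y) (hY' : Measurable Y') (hYm : P.map Y = m) (hYm' : P.map Y' = m')
    {g D : Ω → ℝ} (hg : Integrable g P)
    (hgc : ∀ ω, PathsClose s T X Z X' Z' (Y ω) (Y' ω) (g ω))
    (hD : Integrable D P) (hDξ : ∀ ω, ‖ξ (Y ω) - ξ' (Y' ω)‖ ≤ D ω)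
    {x x' : 𝔼} {g₀ : ℝ} (hg₀ : PathsClose s T X Z X' Z' x x' g₀) :
    PathsClose s T X₁ Z₁ X₁' Z₁' x x'
      ((1 + Lpb) * (‖ξ x - ξ' x'‖ + ∫ ω, D ω ∂P) + (g₀ + ∫ ω, g ω ∂P) / 6) := by
  have hC := hc.C_pos
  have hLp := hc.Lp_pos
  have hLpb := hc.Lp_le
  have hT : T ∈ Icc s T := right_mem_Icc.2 hsT
  set D₀ := ‖ξ x - ξ' x'‖ with hD₀
  have hD₀0 : 0 ≤ D₀ := norm_nonneg _
  set G := ∫ ω, g ω ∂P with hG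
  set E := ∫ ω, D ω ∂P with hE
  have hG0 : 0 ≤ G := integral_nonneg fun ω => (norm_nonneg _).trans (hgc ω T hT).1
  have hE0 : 0 ≤ E := integral_nonneg fun ω => (norm_nonneg _).trans (hDξ ω)
  have hg₀0 : 0 ≤ g₀ := (norm_nonneg _).trans (hg₀ T hT).1
  have hfst : ∀ {x x' : 𝔼} {g₀ : ℝ}, PathsClose s T X Z X' Z' x x' g₀ → ∀ r ∈ Icc s T,
      ‖X₁ r x - X₁' r x'‖ ≤ ‖ξ x - ξ' x'‖ + (T - s) * (C * (2 * g₀ + G)) := fun hg₀ r hr =>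
    k.norm_fst_sub_le hc hm hm' h h' k' hY hY' hYm hYm' hg hgc hg₀ hr
  have hint : ∫ ω, ‖X₁ T (Y ω) - X₁' T (Y' ω)‖ ∂P ≤ E + (T - s) * (C * (3 * G)) := by
    calc _ ≤ ∫ ω, D ω + (T - s) * (C * (2 * g ω + G)) ∂P := by
          refine integral_mono_of_nonneg (Filter.Eventually.of_forall fun _ => norm_nonneg _)
            (by fun_prop) (Filter.Eventually.of_forall fun ω => ?_)
          exact (hfst (hgc ω) T hT).trans (add_le_add_left (hDξ ω) _)
      _ = _ := by
          rw [integral_add hD (by fun_prop), integral_const_mul, integral_const_mul,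
            integral_add (by fun_prop) (by fun_prop), integral_const_mul, integral_const,
            probReal_univ, one_smul, ← hG, ← hE]
          ring
  have hp : ‖p (X₁ T x) (m.map (X₁ T)) - p (X₁' T x') (m'.map (X₁' T))‖ ≤
      Lp * (D₀ + E + (T - s) * C * (2 * g₀ + 4 * G)) := by
    have hcoup := isCoupling_map P (hX₁.measurable.comp hY) (hX₁'.measurable.comp hY')
    rw [← Measure.map_map hX₁.measurable hY, ← Measure.map_map hX₁'.measurable hY', hYm, hYm']
      at hcoup
    refine (hc.lip_p _ _ _ _ _ (hm.map hX₁ hX₁i) (hm'.map hX₁' hX₁i') hcoup).trans ?_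
    rw [integral_isCoupling_map P (hX₁.measurable.comp hY) (hX₁'.measurable.comp hY')]
    refine mul_le_mul_of_nonneg_left ?_ hLp.le
    have := hfst hg₀ T hT
    simp only [Function.comp_apply]
    linarith
  have hb0 : 0 ≤ (T - s) * C := mul_nonneg (by linarith) hC.le
  have ha0 : 0 ≤ (T - s) * C * Lp := mul_nonneg hb0 hLp.le
  have hab : (T - s) * C * Lp + (T - s) * C ≤ 1 / 24 := by
    linarith [mul_le_mul_of_nonneg_left hLpb hb0]
  intro r hr
  constructor
  · refine (hfst hg₀ r hr).trans ?_
    have := mul_nonneg (by linarith : 0 ≤ Lpb) (add_nonneg hD₀0 hE0)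
    nlinarith [mul_le_mul_of_nonneg_right (by linarith : (T - s) * C ≤ 1 / 24)
      (by linarith : 0 ≤ 2 * g₀ + G)]
  · rw [k.snd r hr, k'.snd r hr, add_sub_add_comm]
    have hdr := norm_intervalIntegral_sub_le (h.continuousOn_drift_driver hc hm x).2
      (h'.continuousOn_drift_driver hc hm' x').2 hr hT fun u hu =>
      (hc.norm_drift_sub_driver_sub_le hm hm' (h.coneAdmissible hm hu) (h'.coneAdmissible hm' hu)
        hY hY' hYm hYm' hg (fun ω => (hgc ω u hu).1) (fun ω => (hgc ω u hu).2) (hg₀ u hu).1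
        (hg₀ u hu).2).2
    refine (norm_add_le _ _).trans ((add_le_add hp hdr).trans ?_)
    rw [← hG]
    nlinarith [mul_le_mul_of_nonneg_right hab (by linarith : 0 ≤ 4 * g₀ + 4 * G),
      mul_nonneg ha0 hg₀0, mul_nonneg hb0 hg₀0,
      mul_le_mul_of_nonneg_right hLpb (add_nonneg hD₀0 hE0)]

/-- The class of pairs preserved by the Picard iteration started from the identity map. -/
structure PicardClass (C Lpb s T : ℝ) (m : Measure 𝔼) (X Z : ℝ → 𝔼 → 𝔼) : Prop where
  near : ∀ r ∈ Icc s T, ∀ x, ‖X r x - x‖ ≤ (1 + ‖x‖ + mnorm1 m) / 12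
  bound : ∀ r ∈ Icc s T, ∀ x, ‖Z r x‖ ≤ 3 / 2 * Lpb * (1 + ‖x‖ + mnorm1 m)
  lip : ∀ x x', PathsClose s T X Z X Z x x' (2 * (1 + Lpb) * ‖x - x'‖)
  time_fst : ∀ r ∈ Icc s T, ∀ r' ∈ Icc s T, ∀ x,
    ‖X r x - X r' x‖ ≤ 5 * C * (1 + Lpb) * (1 + ‖x‖ + mnorm1 m) * |r - r'|
  time_snd : ∀ r ∈ Icc s T, ∀ r' ∈ Icc s T, ∀ x,
    ‖Z r x - Z r' x‖ ≤ 5 * C * (1 + Lpb) * (1 + ‖x‖ + mnorm1 m) * |r - r'|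

theorem continuous_of_norm_sub_le {f : 𝔼 → 𝔼} {L : ℝ} (h : ∀ x x', ‖f x - f x'‖ ≤ L * ‖x - x'‖) :
    Continuous f :=
  (LipschitzWith.of_dist_le_mul (K := L.toNNReal) fun x x' => by
    rw [dist_eq_norm, dist_eq_norm]
    exact (h x x').trans
      (mul_le_mul_of_nonneg_right (Real.le_coe_toNNReal L) (norm_nonneg _))).continuous

theorem abs_integral_norm_sub_mnorm1_le {m : Measure 𝔼} (hm : MemP1 m) {f : 𝔼 → 𝔼}
    (hf : Integrable f m) {c : ℝ} (hfc : ∀ x, ‖f x - x‖ ≤ c * (1 + ‖x‖ + mnorm1 m)) :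
    |(∫ y, ‖f y‖ ∂m) - mnorm1 m| ≤ c * (1 + 2 * mnorm1 m) := by
  have := hm.1
  have hi := hm.2
  rw [mnorm1, ← integral_sub hf.norm hm.2, ← Real.norm_eq_abs]
  calc _ ≤ ∫ y, c * (1 + ‖y‖ + mnorm1 m) ∂m :=
        norm_integral_le_of_norm_le (by fun_prop) (Filter.Eventually.of_forall fun y => by
          rw [Real.norm_eq_abs]
          exact (abs_norm_sub_norm_le _ _).trans (hfc y))
    _ = _ := by
        rw [integral_const_mul, integral_add (by fun_prop) (by fun_prop),
          integral_add (by fun_prop) (by fun_prop), integral_const, integral_const, probReal_univ,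
          ← mnorm1]
        simp only [smul_eq_mul]; ring

theorem PicardClass.continuous_fst {s T : ℝ} {m : Measure 𝔼} {X Z : ℝ → 𝔼 → 𝔼}
    (h : PicardClass C Lpb s T m X Z) {r : ℝ} (hr : r ∈ Icc s T) : Continuous (X r) :=
  continuous_of_norm_sub_le fun x x' => (h.lip x x' r hr).1

theorem norm_le_of_near {m : Measure 𝔼} {x y : 𝔼} (h : ‖y - x‖ ≤ (1 + ‖x‖ + mnorm1 m) / 12) :
    ‖y‖ ≤ 2 * (1 + mnorm1 m) * (1 + ‖x‖) := by
  have := norm_le_norm_add_norm_sub' y x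
  nlinarith [norm_nonneg x, mnorm1_nonneg m, mul_nonneg (norm_nonneg x) (mnorm1_nonneg m)]

theorem integrable_of_near {m : Measure 𝔼} (hm : MemP1 m) {f : 𝔼 → 𝔼} (hf : Continuous f)
    (h : ∀ x, ‖f x - x‖ ≤ (1 + ‖x‖ + mnorm1 m) / 12) : Integrable f m :=
  hm.integrable_of_growth hf fun x => norm_le_of_near (h x)

theorem cone_weight_bounds {m : Measure 𝔼} (hm : MemP1 m) {f : 𝔼 → 𝔼}
    (hf : Continuous f) (h : ∀ x, ‖f x - x‖ ≤ (1 + ‖x‖ + mnorm1 m) / 12) (x : 𝔼) :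
    3 / 4 * (1 + ‖x‖ + mnorm1 m) ≤ 1 + ‖f x‖ + ∫ y, ‖f y‖ ∂m ∧
    1 + ‖f x‖ + ∫ y, ‖f y‖ ∂m ≤ 5 / 4 * (1 + ‖x‖ + mnorm1 m) := by
  have h1 := abs_le.1 (abs_integral_norm_sub_mnorm1_le hm (integrable_of_near hm hf h)
    (c := 1 / 12) (by intro y; linarith [h y]))
  have h2 := abs_le.1 ((abs_norm_sub_norm_le _ _).trans (h x))
  constructor <;> linarith [norm_nonneg x, mnorm1_nonneg m]

theorem PicardClass.admissiblePath (hC : 0 < C) (hLpb : 0 < Lpb) {s T : ℝ} {m : Measure 𝔼}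
    (hm : MemP1 m) {X Z : ℝ → 𝔼 → 𝔼} (h : PicardClass C Lpb s T m X Z) :
    AdmissiblePath Lpb ((2 + 2 * Lpb + 5 * C * (1 + Lpb)) * (1 + mnorm1 m)) s T m X Z := by
  have hm0 := mnorm1_nonneg m
  have hw : ∀ {a K : ℝ} (x : 𝔼), 0 ≤ a → a ≤ K → a * (1 + ‖x‖ + mnorm1 m) ≤
      K * (1 + mnorm1 m) * (1 + ‖x‖) := fun {a K} x ha haK => by
    rw [mul_assoc]
    refine mul_le_mul haK ?_ (by positivity) (ha.trans haK)
    nlinarith [mul_nonneg hm0 (norm_nonneg x)]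
  have hCL : 0 ≤ 5 * C * (1 + Lpb) := by positivity
  refine ⟨fun r hr => h.continuous_fst hr, fun r hr => continuous_of_norm_sub_le
    fun x x' => (h.lip x x' r hr).2, fun r hr x => ?_, fun r hr x => ?_, fun r hr r' hr' x => ?_,
    fun r hr r' hr' x => ?_, fun r hr x => ?_⟩
  · refine (norm_le_of_near (h.near r hr x)).trans ?_
    gcongr
    linarith
  · exact (h.bound r hr x).trans (hw x (by positivity) (by linarith))
  · exact (h.time_fst r hr r' hr' x).trans
      (mul_le_mul_of_nonneg_right (hw x hCL (by linarith)) (abs_nonneg _))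
  · exact (h.time_snd r hr r' hr' x).trans
      (mul_le_mul_of_nonneg_right (hw x hCL (by linarith)) (abs_nonneg _))
  · refine (h.bound r hr x).trans ?_
    have := (cone_weight_bounds hm (h.continuous_fst hr) (h.near r hr) x).1
    nlinarith

theorem PicardClass.norm_drift_le (hc : CoeffBounds C Lp Lpb B Ψ Φ p) {s T : ℝ} {m : Measure 𝔼}
    (hm : MemP1 m) {X Z : ℝ → 𝔼 → 𝔼} (h : PicardClass C Lpb s T m X Z) {r : ℝ} (hr : r ∈ Icc s T)
    (x : 𝔼) :
    ‖drift B m (X r) (Z r) x‖ ≤ 2 * C * (1 + Lpb) * (1 + ‖x‖ + mnorm1 m) := by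
  have hC := hc.C_pos
  have hLpb := hc.Lp_pos.trans_le hc.Lp_le
  have ha := (h.admissiblePath hC hLpb hm).coneAdmissible hm hr
  have hw := (cone_weight_bounds hm (h.continuous_fst hr) (h.near r hr) x).2
  have hB := hc.growth_B (X r x) (m.map (X r)) (Z r x) (ha.memP1_map hm)
  rw [mnorm1_map m (h.continuous_fst hr)] at hB
  have hZ := h.bound r hr x
  have : 0 ≤ (1 + ‖x‖ + mnorm1 m) := by have := mnorm1_nonneg m; positivity
  refine hB.trans ?_
  rw [mul_comm 2 C, mul_assoc, mul_assoc]
  refine mul_le_mul_of_nonneg_left ?_ hC.le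
  nlinarith

theorem PicardClass.norm_driver_le (hc : CoeffBounds C Lp Lpb B Ψ Φ p) {s T : ℝ} {m : Measure 𝔼}
    (hm : MemP1 m) {X Z : ℝ → 𝔼 → 𝔼} (h : PicardClass C Lpb s T m X Z) {r : ℝ} (hr : r ∈ Icc s T)
    (x : 𝔼) :
    ‖driver Ψ Φ m (X r) (Z r) x‖ ≤ 5 * C * (1 + Lpb) * (1 + ‖x‖ + mnorm1 m) := by
  have := hm.1
  have hmi := hm.2
  have hC := hc.C_pos
  have hLpb := hc.Lp_pos.trans_le hc.Lp_le
  have ha := (h.admissiblePath hC hLpb hm).coneAdmissible hm hr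
  have hw := (cone_weight_bounds hm (h.continuous_fst hr) (h.near r hr) x).2
  have hΨ := hc.growth_Ψ (X r x) (m.map (X r)) (Z r x) (ha.memP1_map hm)
  rw [mnorm1_map m (h.continuous_fst hr)] at hΨ
  have hZ := h.bound r hr x
  have hm0 := mnorm1_nonneg m
  have hXi := ha.integrable_fst.norm
  set I := ∫ y, ‖X r y‖ ∂m with hI
  have hΦ : ‖∫ xt, Φ (X r xt) (m.map (X r)) (X r x) (Z r xt) ∂m‖ ≤
      C * (1 + 2 * I + ‖X r x‖ + 3 / 2 * Lpb * (1 + 2 * mnorm1 m)) := by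
    calc _ ≤ ∫ xt, C * (‖X r xt‖ + 3 / 2 * Lpb * ‖xt‖ +
          (1 + I + ‖X r x‖ + 3 / 2 * Lpb * (1 + mnorm1 m))) ∂m := by
          refine norm_integral_le_of_norm_le (by fun_prop) (Filter.Eventually.of_forall fun xt => ?_)
          refine (hc.growth_Φ _ _ _ _ (ha.memP1_map hm)).trans ?_
          rw [mnorm1_map m (h.continuous_fst hr), ← hI]
          exact mul_le_mul_of_nonneg_left (by linarith [h.bound r hr xt]) hC.le
      _ = _ := by
          rw [integral_const_mul, integral_add (by fun_prop) (by fun_prop),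
            integral_add (by fun_prop) (by fun_prop), integral_const_mul, integral_const,
            probReal_univ, one_smul, ← hI, ← mnorm1]
          ring
  unfold driver
  refine (norm_add_le _ _).trans ((add_le_add hΦ hΨ).trans ?_)
  rw [← mul_add]
  refine (mul_le_mul_of_nonneg_left
    (?_ : _ ≤ 5 * ((1 + Lpb) * (1 + ‖x‖ + mnorm1 m))) hC.le).trans_eq (by ring)
  nlinarith [norm_nonneg x, norm_nonneg (X r x), mul_nonneg hLpb.le (norm_nonneg x)]

theorem norm_integral_sub_integral_le {f : ℝ → 𝔼} {s T a b c K : ℝ}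
    (hf : ContinuousOn f (Icc s T)) (ha : a ∈ Icc s T) (hb : b ∈ Icc s T) (hc : c ∈ Icc s T)
    (hK : ∀ u ∈ Icc s T, ‖f u‖ ≤ K) :
    ‖(∫ u in c..a, f u) - ∫ u in c..b, f u‖ ≤ K * |a - b| := by
  have hi : ∀ {a b}, a ∈ Icc s T → b ∈ Icc s T → IntervalIntegrable f volume a b :=
    fun ha hb => (hf.mono (uIcc_subset_Icc ha hb)).intervalIntegrable
  rw [intervalIntegral.integral_interval_sub_left (hi hc ha) (hi hc hb)]
  exact intervalIntegral.norm_integral_le_of_norm_le_const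
    fun u hu => hK u (uIcc_subset_Icc hb ha (uIoc_subset_uIcc hu))

theorem PicardClass.step (hc : CoeffBounds C Lp Lpb B Ψ Φ p) {s T : ℝ} (hsT : s ≤ T)
    (hε : 24 * C * (1 + Lpb) * (T - s) ≤ 1) (hε' : 24 * C * (1 + Lpb) * (T - s) ≤ Lpb)
    {m : Measure 𝔼} (hm : MemP1 m) {X Z X₁ Z₁ : ℝ → 𝔼 → 𝔼} (h : PicardClass C Lpb s T m X Z)
    (k : IsPicardStep B Ψ Φ p s T m id X Z X₁ Z₁) : PicardClass C Lpb s T m X₁ Z₁ := by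
  have := hm.1
  have hC := hc.C_pos
  have hLpb := hc.Lp_pos.trans_le hc.Lp_le
  have hpath := h.admissiblePath hC hLpb hm
  have hm0 := mnorm1_nonneg m
  have hw0 : ∀ x : 𝔼, 0 ≤ 1 + ‖x‖ + mnorm1 m := fun x => by positivity
  have hs : s ∈ Icc s T := left_mem_Icc.2 hsT
  have hT : T ∈ Icc s T := right_mem_Icc.2 hsT
  have hdrift := fun x => (hpath.continuousOn_drift_driver hc hm x).1
  have hdriver := fun x => (hpath.continuousOn_drift_driver hc hm x).2
  have hnear : ∀ r ∈ Icc s T, ∀ x, ‖X₁ r x - x‖ ≤ (1 + ‖x‖ + mnorm1 m) / 12 := fun r hr x => by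
    have h1 := norm_integral_sub_integral_le (hdrift x) hr hs hs
      fun u hu => h.norm_drift_le hc hm hu x
    rw [intervalIntegral.integral_same, sub_zero, abs_of_nonneg (by linarith [hr.1])] at h1
    rw [k.fst r hr x, id, add_sub_cancel_left]
    refine h1.trans ?_
    have h2 : 2 * C * (1 + Lpb) * (r - s) ≤ 2 * C * (1 + Lpb) * (T - s) := by
      gcongr; exact hr.2
    nlinarith [mul_le_mul_of_nonneg_right (by linarith : 2 * C * (1 + Lpb) * (r - s) ≤ 1 / 12)
      (hw0 x)]
  have hg0 : ∀ y, PathsClose s T X Z X Z (id y) (id y) 0 := fun y u hu => by simp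
  have hlipX : ∀ r ∈ Icc s T, Continuous (X₁ r) := fun r hr => by
    refine continuous_of_norm_sub_le (L := 1 + (T - s) * (C * (2 * (2 * (1 + Lpb)))))
      fun x x' => ?_
    have := k.norm_fst_sub_le hc hm hm hpath hpath k (P := m) measurable_id measurable_id
      Measure.map_id Measure.map_id (integrable_const 0) hg0 (h.lip x x') hr
    refine this.trans_eq ?_
    simp only [integral_zero, id]
    ring
  have hX₁i := integrable_of_near hm (hlipX T hT) (hnear T hT)
  refine ⟨hnear, fun r hr x => ?_, fun x x' => ?_, fun r hr r' hr' x => ?_,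
    fun r hr r' hr' x => ?_⟩
  · have h1 := norm_integral_sub_integral_le (hdriver x) hr hT hT
      fun u hu => h.norm_driver_le hc hm hu x
    rw [intervalIntegral.integral_same, sub_zero, abs_of_nonpos (by linarith [hr.2]),
      intervalIntegral.integral_symm, norm_neg] at h1
    have h2 := hc.growth_p (X₁ T x) (m.map (X₁ T)) (hm.map (hlipX T hT) hX₁i)
    rw [mnorm1_map m (hlipX T hT)] at h2
    have h3 := (cone_weight_bounds hm (hlipX T hT) (hnear T hT) x).2
    have h4 : 5 * C * (1 + Lpb) * (T - r) ≤ 5 * C * (1 + Lpb) * (T - s) := by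
      gcongr; exact hr.1
    rw [k.snd r hr x]
    refine (norm_add_le _ _).trans ((add_le_add h2 h1).trans ?_)
    nlinarith [mul_le_mul_of_nonneg_right (by linarith : 5 * C * (1 + Lpb) * (T - r) ≤ Lpb / 4)
      (hw0 x), mul_le_mul_of_nonneg_left h3 hLpb.le]
  · have := k.pathsClose hc hsT hε hm hm hpath hpath k (hlipX T hT) hX₁i (hlipX T hT) hX₁i
      (P := m) measurable_id measurable_id Measure.map_id Measure.map_id (integrable_const 0) hg0
      (D := fun _ => 0) (integrable_const 0) (by simp) (h.lip x x')
    simp only [integral_zero, id, add_zero] at this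
    intro u hu
    have hn : 0 ≤ (1 + Lpb) * ‖x - x'‖ := by positivity
    constructor
    · linarith [(this u hu).1]
    · linarith [(this u hu).2]
  · rw [k.fst r hr, k.fst r' hr', add_sub_add_left_eq_sub]
    refine norm_integral_sub_integral_le (hdrift x) hr hr' hs fun u hu =>
      (h.norm_drift_le hc hm hu x).trans (mul_le_mul_of_nonneg_right ?_ (hw0 x))
    gcongr; norm_num
  · rw [k.snd r hr, k.snd r' hr', add_sub_add_left_eq_sub, intervalIntegral.integral_symm T r,
      intervalIntegral.integral_symm T r', ← neg_sub', norm_neg]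
    exact norm_integral_sub_integral_le (hdriver x) hr hr' hT fun u hu =>
      h.norm_driver_le hc hm hu x

theorem PicardClass.contraction (hc : CoeffBounds C Lp Lpb B Ψ Φ p) {s T : ℝ} (hsT : s ≤ T)
    (hε : 24 * C * (1 + Lpb) * (T - s) ≤ 1) (hε' : 24 * C * (1 + Lpb) * (T - s) ≤ Lpb)
    {m : Measure 𝔼} (hm : MemP1 m) {X Z X₁ Z₁ X' Z' X₁' Z₁' : ℝ → 𝔼 → 𝔼}
    (h : PicardClass C Lpb s T m X Z) (k : IsPicardStep B Ψ Φ p s T m id X Z X₁ Z₁)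
    (h' : PicardClass C Lpb s T m X' Z') (k' : IsPicardStep B Ψ Φ p s T m id X' Z' X₁' Z₁')
    {N : ℝ} (hN : 0 ≤ N) (hclose : ∀ x, PathsClose s T X Z X' Z' x x (N * (1 + ‖x‖ + mnorm1 m)))
    (x : 𝔼) : PathsClose s T X₁ Z₁ X₁' Z₁' x x (N / 2 * (1 + ‖x‖ + mnorm1 m)) := by
  have := hm.1
  have hmi := hm.2
  have hC := hc.C_pos
  have hLpb := hc.Lp_pos.trans_le hc.Lp_le
  have hT : T ∈ Icc s T := right_mem_Icc.2 hsT
  have h₁ := h.step hc hsT hε hε' hm k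
  have h₁' := h'.step hc hsT hε hε' hm k'
  have hcl := k.pathsClose hc hsT hε hm hm (h.admissiblePath hC hLpb hm)
    (h'.admissiblePath hC hLpb hm) k' (h₁.continuous_fst hT)
    (integrable_of_near hm (h₁.continuous_fst hT) (h₁.near T hT)) (h₁'.continuous_fst hT)
    (integrable_of_near hm (h₁'.continuous_fst hT) (h₁'.near T hT))
    (P := m) measurable_id measurable_id Measure.map_id Measure.map_id
    (g := fun y => N * (1 + ‖y‖ + mnorm1 m)) (by fun_prop) hclose
    (D := fun _ => 0) (integrable_const 0) (by simp) (hclose x)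
  have hG : ∫ y, N * (1 + ‖y‖ + mnorm1 m) ∂m = N * (1 + 2 * mnorm1 m) := by
    rw [integral_const_mul, integral_add (by fun_prop) (by fun_prop),
      integral_add (by fun_prop) (by fun_prop), integral_const, integral_const, probReal_univ,
      ← mnorm1]
    simp only [smul_eq_mul]; ring
  rw [hG] at hcl
  simp only [sub_self, norm_zero, integral_zero, add_zero, mul_zero, zero_add] at hcl
  have hle : (N * (1 + ‖x‖ + mnorm1 m) + N * (1 + 2 * mnorm1 m)) / 6 ≤
      N / 2 * (1 + ‖x‖ + mnorm1 m) := by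
    have := mnorm1_nonneg m
    nlinarith [mul_nonneg hN (norm_nonneg x)]
  exact fun u hu => ⟨(hcl u hu).1.trans hle, (hcl u hu).2.trans hle⟩

/-- The Picard map of the Lagrangian forward–backward system. -/
noncomputable def picardMap (B Ψ : 𝔼 → Measure 𝔼 → 𝔼 → 𝔼) (Φ : 𝔼 → Measure 𝔼 → 𝔼 → 𝔼 → 𝔼)
    (p : 𝔼 → Measure 𝔼 → 𝔼) (s T : ℝ) (m : Measure 𝔼) (ξ : 𝔼 → 𝔼)
    (q : (ℝ → 𝔼 → 𝔼) × (ℝ → 𝔼 → 𝔼)) : (ℝ → 𝔼 → 𝔼) × (ℝ → 𝔼 → 𝔼) :=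
  let X₁ : ℝ → 𝔼 → 𝔼 := fun r x => ξ x + ∫ u in s..r, drift B m (q.1 u) (q.2 u) x
  (X₁, fun r x => p (X₁ T x) (m.map (X₁ T)) + ∫ u in r..T, driver Ψ Φ m (q.1 u) (q.2 u) x)

theorem isPicardStep_picardMap (s T : ℝ) (m : Measure 𝔼) (ξ : 𝔼 → 𝔼)
    (q : (ℝ → 𝔼 → 𝔼) × (ℝ → 𝔼 → 𝔼)) :
    IsPicardStep B Ψ Φ p s T m ξ q.1 q.2 (picardMap B Ψ Φ p s T m ξ q).1
      (picardMap B Ψ Φ p s T m ξ q).2 :=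
  ⟨fun _ _ _ => rfl, fun _ _ _ => rfl⟩

theorem picardClass_id (hC : 0 < C) (hLpb : 0 < Lpb) (s T : ℝ) (m : Measure 𝔼) :
    PicardClass C Lpb s T m (fun _ x => x) fun _ _ => 0 := by
  have hm0 := mnorm1_nonneg m
  refine ⟨fun r _ x => ?_, fun r _ x => ?_, fun x x' u _ => ?_, fun r _ r' _ x => ?_,
    fun r _ r' _ x => ?_⟩
  · rw [sub_self, norm_zero]; positivity
  · rw [norm_zero]; positivity
  · simp only [sub_self, norm_zero]
    exact ⟨le_mul_of_one_le_left (norm_nonneg _) (by linarith), by positivity⟩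
  · rw [sub_self, norm_zero]; positivity
  · rw [sub_self, norm_zero]; positivity

theorem PicardClass.of_tendsto {s T : ℝ} {m : Measure 𝔼} {X Z : ℕ → ℝ → 𝔼 → 𝔼}
    (h : ∀ n, PicardClass C Lpb s T m (X n) (Z n)) {X' Z' : ℝ → 𝔼 → 𝔼}
    (hX : ∀ r ∈ Icc s T, ∀ x, Filter.Tendsto (fun n => X n r x) Filter.atTop (nhds (X' r x)))
    (hZ : ∀ r ∈ Icc s T, ∀ x, Filter.Tendsto (fun n => Z n r x) Filter.atTop (nhds (Z' r x))) :
    PicardClass C Lpb s T m X' Z' where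
  near r hr x := le_of_tendsto' ((hX r hr x).sub_const x).norm fun n => (h n).near r hr x
  bound r hr x := le_of_tendsto' (hZ r hr x).norm fun n => (h n).bound r hr x
  lip x x' u hu :=
    ⟨le_of_tendsto' ((hX u hu x).sub (hX u hu x')).norm fun n => ((h n).lip x x' u hu).1,
      le_of_tendsto' ((hZ u hu x).sub (hZ u hu x')).norm fun n => ((h n).lip x x' u hu).2⟩
  time_fst r hr r' hr' x :=
    le_of_tendsto' ((hX r hr x).sub (hX r' hr' x)).norm fun n => (h n).time_fst r hr r' hr' x
  time_snd r hr r' hr' x :=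
    le_of_tendsto' ((hZ r hr x).sub (hZ r' hr' x)).norm fun n => (h n).time_snd r hr r' hr' x

theorem exists_lim_of_geometric {f : ℕ → ℝ → 𝔼 → 𝔼} {S : Set ℝ} {K : 𝔼 → ℝ}
    (h : ∀ n, ∀ r ∈ S, ∀ x, ‖f n r x - f (n + 1) r x‖ ≤ K x * (1 / 2) ^ n) :
    ∃ f' : ℝ → 𝔼 → 𝔼, ∀ r ∈ S, ∀ x,
      Filter.Tendsto (fun n => f n r x) Filter.atTop (nhds (f' r x)) ∧
      ∀ n, ‖f n r x - f' r x‖ ≤ 2 * K x * (1 / 2) ^ n := by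
  have hd : ∀ r ∈ S, ∀ x n, dist (f n r x) (f (n + 1) r x) ≤ K x * (1 / 2) ^ n :=
    fun r hr x n => by rw [dist_eq_norm]; exact h n r hr x
  have hl : ∀ r x, ∃ y, r ∈ S → Filter.Tendsto (fun n => f n r x) Filter.atTop (nhds y) := by
    intro r x
    by_cases hr : r ∈ S
    · obtain ⟨y, hy⟩ := cauchySeq_tendsto_of_complete
        (cauchySeq_of_le_geometric (1 / 2) (K x) (by norm_num) (hd r hr x))
      exact ⟨y, fun _ => hy⟩
    · exact ⟨0, fun hr' => absurd hr' hr⟩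
  choose f' hf' using hl
  refine ⟨f', fun r hr x => ⟨hf' r x hr, fun n => ?_⟩⟩
  rw [← dist_eq_norm]
  refine (dist_le_of_le_geometric_of_tendsto (1 / 2) (K x) (by norm_num) (hd r hr x)
    (hf' r x hr) n).trans_eq ?_
  ring

theorem exists_picardClass_fixedPoint (hc : CoeffBounds C Lp Lpb B Ψ Φ p) {s T : ℝ} (hsT : s ≤ T)
    (hε : 24 * C * (1 + Lpb) * (T - s) ≤ 1) (hε' : 24 * C * (1 + Lpb) * (T - s) ≤ Lpb)
    {m : Measure 𝔼} (hm : MemP1 m) :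
    ∃ X Z, PicardClass C Lpb s T m X Z ∧ IsPicardStep B Ψ Φ p s T m id X Z X Z := by
  have hC := hc.C_pos
  have hLpb := hc.Lp_pos.trans_le hc.Lp_le
  have hm0 := mnorm1_nonneg m
  let q : ℕ → (ℝ → 𝔼 → 𝔼) × (ℝ → 𝔼 → 𝔼) := fun n =>
    (picardMap B Ψ Φ p s T m id)^[n] (fun _ x => x, fun _ _ => 0)
  have hq : ∀ n, q (n + 1) = picardMap B Ψ Φ p s T m id (q n) := fun n =>
    Function.iterate_succ_apply' _ _ _
  have hk : ∀ n, IsPicardStep B Ψ Φ p s T m id (q n).1 (q n).2 (q (n + 1)).1 (q (n + 1)).2 :=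
    fun n => by rw [hq]; exact isPicardStep_picardMap s T m id (q n)
  have hP : ∀ n, PicardClass C Lpb s T m (q n).1 (q n).2 := fun n => by
    induction n with
    | zero => exact picardClass_id hC hLpb s T m
    | succ n ih => exact ih.step hc hsT hε hε' hm (hk n)
  have hcl : ∀ n x, PathsClose s T (q n).1 (q n).2 (q (n + 1)).1 (q (n + 1)).2 x x
      (2 * (1 + Lpb) * (1 / 2) ^ n * (1 + ‖x‖ + mnorm1 m)) := fun n => by
    induction n with
    | zero =>
      intro x u hu
      have hw : 0 ≤ 1 + ‖x‖ + mnorm1 m := by positivity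
      constructor
      · rw [norm_sub_rev]
        refine ((hP 1).near u hu x).trans ?_
        nlinarith [mul_nonneg hLpb.le hw]
      · rw [norm_sub_rev]
        change ‖(q 1).2 u x - 0‖ ≤ _
        rw [sub_zero]
        refine ((hP 1).bound u hu x).trans ?_
        nlinarith [mul_nonneg hLpb.le hw]
    | succ n ih =>
      intro x
      have := (hP n).contraction hc hsT hε hε' hm (hk n) (hP (n + 1)) (hk (n + 1))
        (by positivity) ih x
      rwa [show 2 * (1 + Lpb) * (1 / 2) ^ n / 2 = 2 * (1 + Lpb) * (1 / 2) ^ (n + 1) by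
        rw [pow_succ]; ring] at this
  obtain ⟨X, hX⟩ := exists_lim_of_geometric (S := Icc s T) (f := fun n => (q n).1)
    (K := fun x => 2 * (1 + Lpb) * (1 + ‖x‖ + mnorm1 m)) fun n r hr x =>
      (hcl n x r hr).1.trans_eq (by ring)
  obtain ⟨Z, hZ⟩ := exists_lim_of_geometric (S := Icc s T) (f := fun n => (q n).2)
    (K := fun x => 2 * (1 + Lpb) * (1 + ‖x‖ + mnorm1 m)) fun n r hr x =>
      (hcl n x r hr).2.trans_eq (by ring)
  have hXZ : PicardClass C Lpb s T m X Z := PicardClass.of_tendsto hP (fun r hr x => (hX r hr x).1)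
    fun r hr x => (hZ r hr x).1
  have hlim : ∀ n x, PathsClose s T (q n).1 (q n).2 X Z x x
      (4 * (1 + Lpb) * (1 / 2) ^ n * (1 + ‖x‖ + mnorm1 m)) := fun n x u hu =>
    ⟨((hX u hu x).2 n).trans_eq (by ring), ((hZ u hu x).2 n).trans_eq (by ring)⟩
  have hk' := isPicardStep_picardMap (B := B) (Ψ := Ψ) (Φ := Φ) (p := p) s T m id (X, Z)
  have hstep : ∀ n x, PathsClose s T (q (n + 1)).1 (q (n + 1)).2
      (picardMap B Ψ Φ p s T m id (X, Z)).1 (picardMap B Ψ Φ p s T m id (X, Z)).2 x x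
      (4 * (1 + Lpb) * (1 / 2) ^ n / 2 * (1 + ‖x‖ + mnorm1 m)) := fun n x =>
    (hP n).contraction hc hsT hε hε' hm (hk n) hXZ hk' (by positivity) (hlim n) x
  have hzero : ∀ x : 𝔼, Filter.Tendsto
      (fun n : ℕ => 4 * (1 + Lpb) * (1 / 2) ^ n / 2 * (1 + ‖x‖ + mnorm1 m))
      Filter.atTop (nhds 0) := fun x => by
    have := (((tendsto_pow_atTop_nhds_zero_of_lt_one (r := (1 / 2 : ℝ)) (by norm_num)
      (by norm_num)).const_mul (4 * (1 + Lpb))).div_const 2).mul_const (1 + ‖x‖ + mnorm1 m)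
    simpa using this
  have hXeq : ∀ r ∈ Icc s T, ∀ x, X r x = (picardMap B Ψ Φ p s T m id (X, Z)).1 r x :=
    fun r hr x => tendsto_nhds_unique ((hX r hr x).1.comp (Filter.tendsto_add_atTop_nat 1))
      (tendsto_iff_norm_sub_tendsto_zero.2 (squeeze_zero (fun _ => norm_nonneg _)
        (fun n => (hstep n x r hr).1) (hzero x)))
  have hZeq : ∀ r ∈ Icc s T, ∀ x, Z r x = (picardMap B Ψ Φ p s T m id (X, Z)).2 r x :=
    fun r hr x => tendsto_nhds_unique ((hZ r hr x).1.comp (Filter.tendsto_add_atTop_nat 1))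
      (tendsto_iff_norm_sub_tendsto_zero.2 (squeeze_zero (fun _ => norm_nonneg _)
        (fun n => (hstep n x r hr).2) (hzero x)))
  refine ⟨X, Z, hXZ, fun r hr x => (hXeq r hr x).trans (hk'.fst r hr x), fun r hr x => ?_⟩
  have hXT : X T = (picardMap B Ψ Φ p s T m id (X, Z)).1 T :=
    funext fun y => hXeq T (right_mem_Icc.2 hsT) y
  rw [hXT]
  exact (hZeq r hr x).trans (hk'.snd r hr x)

theorem AdmissiblePath.nonneg {Q s T : ℝ} {m : Measure 𝔼} {X Z : ℝ → 𝔼 → 𝔼}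
    (h : AdmissiblePath Lpb Q s T m X Z) (hsT : s ≤ T) : 0 ≤ Q := by
  have := (norm_nonneg _).trans (h.growth_fst s (left_mem_Icc.2 hsT) 0)
  simpa using this

/-- Stability of solutions of the Lagrangian forward–backward system with respect to the initial
map and the reference measure. -/
theorem IsPicardStep.pathsClose_of_solutions (hc : CoeffBounds C Lp Lpb B Ψ Φ p) {s T Q Q' : ℝ}
    (hsT : s ≤ T) (hε : 24 * C * (1 + Lpb) * (T - s) ≤ 1)
    {m m' : Measure 𝔼} (hm : MemP1 m) (hm' : MemP1 m') {X Z X' Z' : ℝ → 𝔼 → 𝔼}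
    (h : AdmissiblePath Lpb Q s T m X Z) (h' : AdmissiblePath Lpb Q' s T m' X' Z')
    {ξ ξ' : 𝔼 → 𝔼}
    (k : IsPicardStep B Ψ Φ p s T m ξ X Z X Z) (k' : IsPicardStep B Ψ Φ p s T m' ξ' X' Z' X' Z')
    {Ω : Type*} [MeasurableSpace Ω] {P : Measure Ω} [IsProbabilityMeasure P] {Y Y' : Ω → 𝔼}
    (hY : Measurable Y) (hY' : Measurable Y') (hYm : P.map Y = m) (hYm' : P.map Y' = m')
    (hD : Integrable (fun ω => ‖ξ (Y ω) - ξ' (Y' ω)‖) P) (x x' : 𝔼) :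
    PathsClose s T X Z X' Z' x x'
      (2 * (1 + Lpb) * (‖ξ x - ξ' x'‖ + ∫ ω, ‖ξ (Y ω) - ξ' (Y' ω)‖ ∂P)) := by
  have hLpb := hc.Lp_pos.trans_le hc.Lp_le
  have hT : T ∈ Icc s T := right_mem_Icc.2 hsT
  have hYi : Integrable (fun ω => ‖Y ω‖) P := by
    have := hm.2
    rwa [← hYm, integrable_map_measure continuous_norm.aestronglyMeasurable hY.aemeasurable] at this
  have hYi' : Integrable (fun ω => ‖Y' ω‖) P := by
    have := hm'.2
    rwa [← hYm', integrable_map_measure continuous_norm.aestronglyMeasurable hY'.aemeasurable]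
      at this
  set E := ∫ ω, ‖ξ (Y ω) - ξ' (Y' ω)‖ ∂P with hE
  have hE0 : 0 ≤ E := integral_nonneg fun ω => norm_nonneg _
  let v : 𝔼 → 𝔼 → ℝ := fun x x' => Q * (1 + ‖x‖) + Q' * (1 + ‖x'‖)
  have hv : Integrable (fun ω => v (Y ω) (Y' ω)) P :=
    (((integrable_const 1).add hYi).const_mul Q).add (((integrable_const 1).add hYi').const_mul Q')
  have hv0 : ∀ x x', 0 ≤ v x x' := fun x x' => by
    have := h.nonneg hsT
    have := h'.nonneg hsT
    positivity
  set V := ∫ ω, v (Y ω) (Y' ω) ∂P with hV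
  have hV0 : 0 ≤ V := integral_nonneg fun ω => hv0 _ _
  have key : ∀ n : ℕ, ∀ x x', PathsClose s T X Z X' Z' x x'
      (2 * (1 + Lpb) * (‖ξ x - ξ' x'‖ + E) + (1 / 2) ^ n * (v x x' + V)) := fun n => by
    induction n with
    | zero =>
      intro x x' u hu
      have h0 : 0 ≤ 2 * (1 + Lpb) * (‖ξ x - ξ' x'‖ + E) := by positivity
      constructor
      · refine (norm_sub_le _ _).trans ((add_le_add (h.growth_fst u hu x)
          (h'.growth_fst u hu x')).trans ?_)
        rw [pow_zero, one_mul]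
        change v x x' ≤ _
        linarith
      · refine (norm_sub_le _ _).trans ((add_le_add (h.growth_snd u hu x)
          (h'.growth_snd u hu x')).trans ?_)
        rw [pow_zero, one_mul]
        change v x x' ≤ _
        linarith
    | succ n ih =>
      intro x x'
      have hcl := k.pathsClose hc hsT hε hm hm' h h' k' (h.continuous_fst T hT)
        (h.coneAdmissible hm hT).integrable_fst (h'.continuous_fst T hT)
        (h'.coneAdmissible hm' hT).integrable_fst hY hY' hYm hYm'
        (g := fun ω => 2 * (1 + Lpb) * (‖ξ (Y ω) - ξ' (Y' ω)‖ + E) +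
          (1 / 2) ^ n * (v (Y ω) (Y' ω) + V))
        (((hD.add (integrable_const E)).const_mul _).add
          ((hv.add (integrable_const V)).const_mul _))
        (fun ω => ih (Y ω) (Y' ω)) hD (fun ω => le_rfl) (ih x x')
      have hG : ∫ ω, (2 * (1 + Lpb) * (‖ξ (Y ω) - ξ' (Y' ω)‖ + E) +
          (1 / 2) ^ n * (v (Y ω) (Y' ω) + V)) ∂P =
          2 * (1 + Lpb) * (E + E) + (1 / 2) ^ n * (V + V) := by
        have hvi : Integrable (fun ω => (1 / 2) ^ n * (v (Y ω) (Y' ω) + V)) P :=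
          (hv.add (integrable_const V)).const_mul _
        rw [integral_add (by fun_prop) hvi,
          integral_const_mul, integral_const_mul, integral_add hD (integrable_const E), integral_add hv (integrable_const V),
          integral_const, integral_const, probReal_univ, one_smul, one_smul]
      rw [hG, ← hE] at hcl
      have hle : (1 + Lpb) * (‖ξ x - ξ' x'‖ + E) +
          (2 * (1 + Lpb) * (‖ξ x - ξ' x'‖ + E) + (1 / 2) ^ n * (v x x' + V) +
            (2 * (1 + Lpb) * (E + E) + (1 / 2) ^ n * (V + V))) / 6 ≤
          2 * (1 + Lpb) * (‖ξ x - ξ' x'‖ + E) + (1 / 2) ^ (n + 1) * (v x x' + V) := by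
        have h1 : 0 ≤ (1 / 2 : ℝ) ^ n * v x x' := mul_nonneg (by positivity) (hv0 x x')
        have h2 : 0 ≤ (1 / 2 : ℝ) ^ n * V := by positivity
        have h3 : 0 ≤ (1 + Lpb) * ‖ξ x - ξ' x'‖ := by positivity
        have h4 : 0 ≤ (1 + Lpb) * E := by positivity
        rw [pow_succ]
        linarith
      exact fun u hu => ⟨(hcl u hu).1.trans hle, (hcl u hu).2.trans hle⟩
  have hlim : Filter.Tendsto (fun n : ℕ => 2 * (1 + Lpb) * (‖ξ x - ξ' x'‖ + E) +
      (1 / 2) ^ n * (v x x' + V)) Filter.atTop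
      (nhds (2 * (1 + Lpb) * (‖ξ x - ξ' x'‖ + E))) := by
    simpa using ((tendsto_pow_atTop_nhds_zero_of_lt_one (r := (1 / 2 : ℝ)) (by norm_num)
      (by norm_num)).mul_const (v x x' + V)).const_add (2 * (1 + Lpb) * (‖ξ x - ξ' x'‖ + E))
  exact fun u hu => ⟨ge_of_tendsto' hlim fun n => (key n x x' u hu).1,
    ge_of_tendsto' hlim fun n => (key n x x' u hu).2⟩

theorem AdmissiblePath.restrict {Q s T τ : ℝ} {m : Measure 𝔼} {X Z : ℝ → 𝔼 → 𝔼}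
    (h : AdmissiblePath Lpb Q s T m X Z) (hτ : s ≤ τ) : AdmissiblePath Lpb Q τ T m X Z where
  continuous_fst r hr := h.continuous_fst r ⟨hτ.trans hr.1, hr.2⟩
  continuous_snd r hr := h.continuous_snd r ⟨hτ.trans hr.1, hr.2⟩
  growth_fst r hr := h.growth_fst r ⟨hτ.trans hr.1, hr.2⟩
  growth_snd r hr := h.growth_snd r ⟨hτ.trans hr.1, hr.2⟩
  time_fst r hr r' hr' := h.time_fst r ⟨hτ.trans hr.1, hr.2⟩ r' ⟨hτ.trans hr'.1, hr'.2⟩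
  time_snd r hr r' hr' := h.time_snd r ⟨hτ.trans hr.1, hr.2⟩ r' ⟨hτ.trans hr'.1, hr'.2⟩
  cone r hr := h.cone r ⟨hτ.trans hr.1, hr.2⟩

theorem AdmissiblePath.comp {Q R s T : ℝ} (hsT : s ≤ T) {m : Measure 𝔼} {X Z : ℝ → 𝔼 → 𝔼}
    {f : 𝔼 → 𝔼} (hf : Continuous f) (hR : ∀ x, ‖f x‖ ≤ R * (1 + ‖x‖))
    (h : AdmissiblePath Lpb Q s T (m.map f) X Z) :
    AdmissiblePath Lpb (Q * (1 + R)) s T m (fun r x => X r (f x)) fun r x => Z r (f x) := by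
  have hw : ∀ x, Q * (1 + ‖f x‖) ≤ Q * (1 + R) * (1 + ‖x‖) := fun x => by
    rw [mul_assoc]
    refine mul_le_mul_of_nonneg_left ?_ (h.nonneg hsT)
    linarith [hR x, norm_nonneg x]
  refine ⟨fun r hr => (h.continuous_fst r hr).comp hf, fun r hr => (h.continuous_snd r hr).comp hf,
    fun r hr x => (h.growth_fst r hr _).trans (hw x),
    fun r hr x => (h.growth_snd r hr _).trans (hw x),
    fun r hr r' hr' x => (h.time_fst r hr r' hr' _).trans
      (mul_le_mul_of_nonneg_right (hw x) (abs_nonneg _)),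
    fun r hr r' hr' x => (h.time_snd r hr r' hr' _).trans
      (mul_le_mul_of_nonneg_right (hw x) (abs_nonneg _)), fun r hr x => ?_⟩
  rw [← integral_map (f := fun y => ‖X r y‖) hf.measurable.aemeasurable
    (h.continuous_fst r hr).norm.aestronglyMeasurable]
  exact h.cone r hr (f x)

theorem IsPicardStep.restrict (hc : CoeffBounds C Lp Lpb B Ψ Φ p) {Q s T τ : ℝ} {m : Measure 𝔼}
    (hm : MemP1 m) {X Z : ℝ → 𝔼 → 𝔼} {ξ : 𝔼 → 𝔼} (h : AdmissiblePath Lpb Q s T m X Z)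
    (k : IsPicardStep B Ψ Φ p s T m ξ X Z X Z) (hτ : τ ∈ Icc s T) :
    IsPicardStep B Ψ Φ p τ T m (X τ) X Z X Z where
  fst r hr x := by
    have hr' : r ∈ Icc s T := ⟨hτ.1.trans hr.1, hr.2⟩
    have hs : s ∈ Icc s T := left_mem_Icc.2 (hτ.1.trans hτ.2)
    have hi : ∀ a ∈ Icc s T, ∀ b ∈ Icc s T,
        IntervalIntegrable (fun u => drift B m (X u) (Z u) x) volume a b := fun a ha b hb =>
      ((h.continuousOn_drift_driver hc hm x).1.mono (uIcc_subset_Icc ha hb)).intervalIntegrable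
    rw [k.fst r hr' x, k.fst τ hτ x, add_assoc,
      intervalIntegral.integral_add_adjacent_intervals (hi s hs τ hτ) (hi τ hτ r hr')]
  snd r hr x := k.snd r ⟨hτ.1.trans hr.1, hr.2⟩ x

theorem IsPicardStep.comp (hc : CoeffBounds C Lp Lpb B Ψ Φ p) {Q s T : ℝ} {m : Measure 𝔼}
    {X Z : ℝ → 𝔼 → 𝔼} {f : 𝔼 → 𝔼} (hf : Continuous f) (hm : MemP1 (m.map f))
    (h : AdmissiblePath Lpb Q s T (m.map f) X Z)
    (k : IsPicardStep B Ψ Φ p s T (m.map f) id X Z X Z) :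
    IsPicardStep B Ψ Φ p s T m f (fun r x => X r (f x)) (fun r x => Z r (f x))
      (fun r x => X r (f x)) fun r x => Z r (f x) := by
  have hmap : ∀ u ∈ Icc s T, m.map (fun x => X u (f x)) = (m.map f).map (X u) := fun u hu =>
    (Measure.map_map (h.continuous_fst u hu).measurable hf.measurable).symm
  constructor
  · intro r hr x
    have hs : s ∈ Icc s T := left_mem_Icc.2 (hr.1.trans hr.2)
    rw [k.fst r hr]
    refine congrArg (_ + ·) (intervalIntegral.integral_congr fun u hu => ?_)
    simp only [drift]
    rw [hmap u (uIcc_subset_Icc hs hr hu)]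
  · intro r hr x
    have hT : T ∈ Icc s T := right_mem_Icc.2 (hr.1.trans hr.2)
    rw [k.snd r hr, hmap T hT]
    refine congrArg (_ + ·) (intervalIntegral.integral_congr fun u hu => ?_)
    have hu' := uIcc_subset_Icc hr hT hu
    simp only [driver]
    rw [hmap u hu', integral_map hf.measurable.aemeasurable
      (hc.continuous_Φ hm (h.coneAdmissible hm hu') _).aestronglyMeasurable]

/-- The flow property of solutions of the Lagrangian forward–backward system. -/
theorem IsPicardStep.flow (hc : CoeffBounds C Lp Lpb B Ψ Φ p) {Q Q' s T τ : ℝ}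
    (hε : 24 * C * (1 + Lpb) * (T - s) ≤ 1) {m : Measure 𝔼} (hm : MemP1 m) {ξ : 𝔼 → 𝔼}
    {X Z X' Z' : ℝ → 𝔼 → 𝔼} (hτ : τ ∈ Icc s T) (h : AdmissiblePath Lpb Q s T m X Z)
    (k : IsPicardStep B Ψ Φ p s T m ξ X Z X Z)
    (h' : AdmissiblePath Lpb Q' τ T (m.map (X τ)) X' Z')
    (k' : IsPicardStep B Ψ Φ p τ T (m.map (X τ)) id X' Z' X' Z') {r : ℝ} (hr : r ∈ Icc τ T)
    (x : 𝔼) : Z r x = Z' r (X τ x) := by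
  have := hm.1
  have hC := hc.C_pos
  have hLpb := hc.Lp_pos.trans_le hc.Lp_le
  have hX := h.continuous_fst τ hτ
  have hm' := (h.coneAdmissible hm hτ).memP1_map hm
  have hε' : 24 * C * (1 + Lpb) * (T - τ) ≤ 1 :=
    (mul_le_mul_of_nonneg_left (by linarith [hτ.1]) (by positivity)).trans hε
  have hcl := (k.restrict hc hm h hτ).pathsClose_of_solutions hc hτ.2 hε' hm hm (h.restrict hτ.1)
    (h'.comp hτ.2 hX (h.growth_fst τ hτ)) (k'.comp hc hX hm' h') (P := m) measurable_id
    measurable_id Measure.map_id Measure.map_id (by simp) x x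
  have := (hcl r hr).2
  simp only [sub_self, norm_zero, integral_zero, add_zero, mul_zero] at this
  exact sub_eq_zero.1 (norm_le_zero_iff.1 this)

/-- A family of solutions of the Lagrangian forward–backward system, indexed by the initial time
and the initial law. -/
structure IsSolutionFamily (C Lpb : ℝ) (B Ψ : 𝔼 → Measure 𝔼 → 𝔼 → 𝔼)
    (Φ : 𝔼 → Measure 𝔼 → 𝔼 → 𝔼 → 𝔼) (p : 𝔼 → Measure 𝔼 → 𝔼) (t T : ℝ)
    (X Z : ℝ → Measure 𝔼 → ℝ → 𝔼 → 𝔼) : Prop where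
  picardClass : ∀ s ∈ Icc t T, ∀ m, MemP1 m → PicardClass C Lpb s T m (X s m) (Z s m)
  step : ∀ s ∈ Icc t T, ∀ m, MemP1 m →
    IsPicardStep B Ψ Φ p s T m id (X s m) (Z s m) (X s m) (Z s m)

theorem exists_isSolutionFamily (hc : CoeffBounds C Lp Lpb B Ψ Φ p) {t T : ℝ}
    (hε : 24 * C * (1 + Lpb) * (T - t) ≤ 1) (hε' : 24 * C * (1 + Lpb) * (T - t) ≤ Lpb) :
    ∃ X Z, IsSolutionFamily C Lpb B Ψ Φ p t T X Z := by
  have hC := hc.C_pos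
  have hLpb := hc.Lp_pos.trans_le hc.Lp_le
  have hsol : ∀ s m, ∃ X Z, s ∈ Icc t T → MemP1 m →
      PicardClass C Lpb s T m X Z ∧ IsPicardStep B Ψ Φ p s T m id X Z X Z := fun s m => by
    by_cases h : s ∈ Icc t T ∧ MemP1 m
    · have hle : 24 * C * (1 + Lpb) * (T - s) ≤ 24 * C * (1 + Lpb) * (T - t) :=
        mul_le_mul_of_nonneg_left (by linarith [h.1.1]) (by positivity)
      obtain ⟨X, Z, hXZ⟩ := exists_picardClass_fixedPoint hc h.1.2 (hle.trans hε) (hle.trans hε')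
        h.2
      exact ⟨X, Z, fun _ _ => hXZ⟩
    · exact ⟨0, 0, fun hs hm => absurd ⟨hs, hm⟩ h⟩
  choose X Z hXZ using hsol
  exact ⟨X, Z, fun s hs m hm => (hXZ s m hs hm).1, fun s hs m hm => (hXZ s m hs hm).2⟩

variable {t T : ℝ} {X Z : ℝ → Measure (EuclideanSpace ℝ (Fin d)) → ℝ →
  EuclideanSpace ℝ (Fin d) → EuclideanSpace ℝ (Fin d)}

theorem IsSolutionFamily.fst_self (h : IsSolutionFamily C Lpb B Ψ Φ p t T X Z) {s : ℝ}
    (hs : s ∈ Icc t T) {m : Measure 𝔼} (hm : MemP1 m) (x : 𝔼) : X s m s x = x := by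
  rw [(h.step s hs m hm).fst s (left_mem_Icc.2 hs.2), intervalIntegral.integral_same, add_zero, id]

theorem IsSolutionFamily.flow (hc : CoeffBounds C Lp Lpb B Ψ Φ p)
    (hε : 24 * C * (1 + Lpb) * (T - t) ≤ 1) (h : IsSolutionFamily C Lpb B Ψ Φ p t T X Z)
    {s τ : ℝ} (hs : s ∈ Icc t T) (hτ : τ ∈ Icc s T) {m : Measure 𝔼} (hm : MemP1 m) (x : 𝔼) :
    Z τ (m.map (X s m τ)) τ (X s m τ x) = Z s m τ x := by
  have hC := hc.C_pos
  have hLpb := hc.Lp_pos.trans_le hc.Lp_le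
  have hadm := (h.picardClass s hs m hm).admissiblePath hC hLpb hm
  have hτ' : τ ∈ Icc t T := ⟨hs.1.trans hτ.1, hτ.2⟩
  have hm' := (hadm.coneAdmissible hm hτ).memP1_map hm
  have hle : 24 * C * (1 + Lpb) * (T - s) ≤ 1 :=
    (mul_le_mul_of_nonneg_left (by linarith [hs.1]) (by positivity)).trans hε
  exact ((h.step s hs m hm).flow hc hle hm hτ hadm
    ((h.picardClass τ hτ' _ hm').admissiblePath hC hLpb hm') (h.step τ hτ' _ hm')
    (left_mem_Icc.2 hτ.2) x).symm

theorem IsSolutionFamily.norm_snd_sub_le (hc : CoeffBounds C Lp Lpb B Ψ Φ p)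
    (hε : 24 * C * (1 + Lpb) * (T - t) ≤ 1) (h : IsSolutionFamily C Lpb B Ψ Φ p t T X Z)
    {s : ℝ} (hs : s ∈ Icc t T) {m m' : Measure 𝔼} (hm : MemP1 m) (hm' : MemP1 m')
    {π : Measure (𝔼 × 𝔼)} (hπ : IsCoupling π m m') (x x' : 𝔼) :
    ‖Z s m s x - Z s m' s x'‖ ≤ 2 * (1 + Lpb) * (‖x - x'‖ + ∫ q, ‖q.1 - q.2‖ ∂π) := by
  have hC := hc.C_pos
  have hLpb := hc.Lp_pos.trans_le hc.Lp_le
  have := hπ.1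
  have hle : 24 * C * (1 + Lpb) * (T - s) ≤ 1 :=
    (mul_le_mul_of_nonneg_left (by linarith [hs.1]) (by positivity)).trans hε
  have hi : Integrable (fun q : 𝔼 × 𝔼 => q.1) π := by
    have := hm.2
    rw [← hπ.2.1, integrable_map_measure continuous_norm.aestronglyMeasurable
      measurable_fst.aemeasurable] at this
    exact (integrable_norm_iff continuous_fst.aestronglyMeasurable).1 this
  have hi' : Integrable (fun q : 𝔼 × 𝔼 => q.2) π := by
    have := hm'.2
    rw [← hπ.2.2, integrable_map_measure continuous_norm.aestronglyMeasurable
      measurable_snd.aemeasurable] at this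
    exact (integrable_norm_iff continuous_snd.aestronglyMeasurable).1 this
  exact ((h.step s hs m hm).pathsClose_of_solutions hc hs.2 hle hm hm'
    ((h.picardClass s hs m hm).admissiblePath hC hLpb hm)
    ((h.picardClass s hs m' hm').admissiblePath hC hLpb hm') (h.step s hs m' hm')
    measurable_fst measurable_snd hπ.2.1 hπ.2.2 (hi.sub hi').norm x x' s (left_mem_Icc.2 hs.2)).2

theorem IsSolutionFamily.norm_snd_time_sub_le (hc : CoeffBounds C Lp Lpb B Ψ Φ p)
    (hε : 24 * C * (1 + Lpb) * (T - t) ≤ 1) (h : IsSolutionFamily C Lpb B Ψ Φ p t T X Z)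
    {s s' : ℝ} (hs : s ∈ Icc t T) (hs' : s' ∈ Icc t T) {m : Measure 𝔼} (hm : MemP1 m) (x : 𝔼) :
    ‖Z s m s x - Z s' m s' x‖ ≤
      (1 + 6 * (1 + Lpb)) * (5 * C * (1 + Lpb)) * (1 + ‖x‖ + mnorm1 m) * |s - s'| := by
  wlog hle : s ≤ s' generalizing s s'
  · rw [norm_sub_rev, abs_sub_comm]
    exact this hs' hs (le_of_not_ge hle)
  have hC := hc.C_pos
  have hLpb := hc.Lp_pos.trans_le hc.Lp_le
  have := hm.1
  have hmi := hm.2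
  have hcl := h.picardClass s hs m hm
  have hss : s ∈ Icc s T := left_mem_Icc.2 hs.2
  have hss' : s' ∈ Icc s T := ⟨hle, hs'.2⟩
  have hX := hcl.continuous_fst hss'
  have hm' := hm.map hX (integrable_of_near hm hX (hcl.near s' hss'))
  set K := 5 * C * (1 + Lpb) with hK
  have hK0 : 0 < K := by positivity
  have hXx : ∀ y, ‖X s m s' y - y‖ ≤ K * (1 + ‖y‖ + mnorm1 m) * |s - s'| := fun y => by
    have := hcl.time_fst s hss s' hss' y
    rwa [h.fst_self hs hm, norm_sub_rev] at this
  have hint : ∫ y, ‖X s m s' y - y‖ ∂m ≤ K * (1 + 2 * mnorm1 m) * |s - s'| := by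
    calc _ ≤ ∫ y, K * (1 + ‖y‖ + mnorm1 m) * |s - s'| ∂m :=
          integral_mono_of_nonneg (Filter.Eventually.of_forall fun _ => norm_nonneg _)
            (by fun_prop) (Filter.Eventually.of_forall hXx)
      _ = _ := by
          rw [integral_mul_const, integral_const_mul, integral_add (by fun_prop) (by fun_prop),
            integral_add (by fun_prop) (by fun_prop), integral_const, integral_const,
            probReal_univ, ← mnorm1]
          simp only [smul_eq_mul]; ring
  have hcoup := isCoupling_map m hX.measurable measurable_id
  rw [Measure.map_id] at hcoup
  have hlip := h.norm_snd_sub_le hc hε hs' hm' hm hcoup (X s m s' x) x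
  rw [integral_isCoupling_map m hX.measurable measurable_id, h.flow hc hε hs hss' hm] at hlip
  simp only [id] at hlip
  have htri := norm_sub_le_norm_sub_add_norm_sub (Z s m s x) (Z s m s' x) (Z s' m s' x)
  have htime := hcl.time_snd s hss s' hss' x
  have h1 : 2 * (1 + Lpb) * (‖X s m s' x - x‖ + ∫ y, ‖X s m s' y - y‖ ∂m) ≤
      2 * (1 + Lpb) * (3 * (K * (1 + ‖x‖ + mnorm1 m) * |s - s'|)) := by
    refine mul_le_mul_of_nonneg_left ?_ (by positivity)
    have : K * (1 + 2 * mnorm1 m) * |s - s'| ≤ 2 * (K * (1 + ‖x‖ + mnorm1 m) * |s - s'|) := by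
      rw [← mul_assoc, mul_left_comm]
      refine mul_le_mul_of_nonneg_right (mul_le_mul_of_nonneg_left ?_ hK0.le) (abs_nonneg _)
      linarith [norm_nonneg x]
    linarith [hXx x]
  linarith

/-- Joint continuity of the field read off from a family of solutions. -/
theorem IsSolutionFamily.exists_norm_snd_sub_lt (hc : CoeffBounds C Lp Lpb B Ψ Φ p)
    (hε : 24 * C * (1 + Lpb) * (T - t) ≤ 1) (h : IsSolutionFamily C Lpb B Ψ Φ p t T X Z)
    {s : ℝ} (hs : s ∈ Icc t T) (x : 𝔼) {ν : Measure 𝔼} (hν : MemP1 ν) {e : ℝ} (he : 0 < e) :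
    ∃ δ > (0 : ℝ), ∀ s' ∈ Icc t T, ∀ (x' : 𝔼) ν', MemP1 ν' →
      |s - s'| < δ → ‖x - x'‖ < δ → W1 ν ν' < δ → ‖Z s ν s x - Z s' ν' s' x'‖ < e := by
  have hC := hc.C_pos
  have hLpb := hc.Lp_pos.trans_le hc.Lp_le
  have hν0 := mnorm1_nonneg ν
  set A := (1 + 6 * (1 + Lpb)) * (5 * C * (1 + Lpb)) * (1 + ‖x‖ + mnorm1 ν) with hA
  have hA0 : 0 ≤ A := by positivity
  set M := 2 * (1 + Lpb) with hM
  have hM0 : 0 < M := by positivity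
  refine ⟨e / (A + 2 * M), by positivity, fun s' hs' x' ν' hν' h₁ h₂ h₃ => ?_⟩
  obtain ⟨π, hπ, hπ'⟩ := exists_isCoupling_lt_of_W1_lt hν hν' h₃
  set δ := e / (A + 2 * M) with hδ
  have hAδ : A * δ + M * (δ + δ) = e := by
    rw [hδ]; field_simp; ring
  calc _ ≤ ‖Z s ν s x - Z s' ν s' x‖ + ‖Z s' ν s' x - Z s' ν' s' x'‖ :=
        norm_sub_le_norm_sub_add_norm_sub _ _ _
    _ ≤ A * |s - s'| + M * (‖x - x'‖ + ∫ q, ‖q.1 - q.2‖ ∂π) :=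
        add_le_add (h.norm_snd_time_sub_le hc hε hs hs' hν x)
          (h.norm_snd_sub_le hc hε hs' hν hν' hπ x x')
    _ < A * δ + M * (δ + δ) :=
        add_lt_add_of_le_of_lt (mul_le_mul_of_nonneg_left h₁.le hA0)
          (mul_lt_mul_of_pos_left (add_lt_add h₂ hπ') hM0)
    _ = e := hAδ

theorem PicardClass.continuousOn_uncurry (hLpb : 0 < Lpb) {s : ℝ} {m : Measure 𝔼}
    {X Z : ℝ → 𝔼 → 𝔼} (h : PicardClass C Lpb s T m X Z) :
    ContinuousOn (fun q : ℝ × 𝔼 => X q.1 q.2) (Icc s T ×ˢ (univ : Set 𝔼)) := by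
  refine continuousOn_prod_of_continuousOn_lipschitzOnWith' (fun q : ℝ × 𝔼 => X q.1 q.2)
    (2 * (1 + Lpb)).toNNReal (fun r hr => ?_) fun x _ => ?_
  · refine LipschitzOnWith.of_dist_le_mul fun x _ x' _ => ?_
    rw [dist_eq_norm, dist_eq_norm, Real.coe_toNNReal _ (by positivity)]
    exact (h.lip x x' r hr).1
  · exact continuousOn_of_norm_sub_le fun u hu v hv => h.time_fst u hu v hv x

end

/-- Theorem 7.2, local-in-time existence of a decoupling field, with the
composite coefficients abstracted into `B`, `Ψ`, `Φ` and the terminal datum `p`: there is an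
`ε > 0`, depending only on `C`, `L_p`, `L̄_p`, such that on any time interval `[t, T̃]` of
length `≤ ε` there is a jointly continuous decoupling field `γ` with
`‖γ(s,x,m)‖ ≤ 2 L̄_p (1 + ‖x‖ + ‖m‖₁)`, and for every `(s, m)` a jointly continuous flow
`X^{s,m}` solving the forward equation, with `γ` given by the backward representation; in
particular `Z^{s,m}_τ(x) = γ(τ, X^{s,m}_τ(x), (X^{s,m}_τ)_# m)` satisfies the cone
condition. -/
theorem stmt_9 (C Lp Lpb : ℝ) (hC : 0 < C) (hLp : 0 < Lp) (hLpLpb : Lp ≤ Lpb) :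
    ∃ ε > (0:ℝ), ∀ (d : ℕ), 1 ≤ d →
      ∀ (B Ψ : EuclideanSpace ℝ (Fin d) → Measure (EuclideanSpace ℝ (Fin d)) →
          EuclideanSpace ℝ (Fin d) → EuclideanSpace ℝ (Fin d))
        (Φ : EuclideanSpace ℝ (Fin d) → Measure (EuclideanSpace ℝ (Fin d)) →
          EuclideanSpace ℝ (Fin d) → EuclideanSpace ℝ (Fin d) → EuclideanSpace ℝ (Fin d))
        (p : EuclideanSpace ℝ (Fin d) → Measure (EuclideanSpace ℝ (Fin d)) →
          EuclideanSpace ℝ (Fin d)),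
      -- (i) growth
      (∀ x ν z, MemP1 ν → ‖B x ν z‖ ≤ C * (1 + ‖x‖ + mnorm1 ν + ‖z‖)) →
      (∀ x ν z, MemP1 ν → ‖Ψ x ν z‖ ≤ C * (1 + ‖x‖ + mnorm1 ν + ‖z‖)) →
      (∀ xt ν x zt, MemP1 ν → ‖Φ xt ν x zt‖ ≤ C * (1 + ‖xt‖ + mnorm1 ν + ‖x‖ + ‖zt‖)) →
      (∀ x ν, MemP1 ν → ‖p x ν‖ ≤ Lpb * (1 + ‖x‖ + mnorm1 ν)) →
      -- (ii) Lipschitz continuity on the cone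
      (∀ x x' ν ν' z z' π, MemP1 ν → MemP1 ν' → IsCoupling π ν ν' →
        ‖z‖ ≤ 2 * Lpb * (1 + ‖x‖ + mnorm1 ν) → ‖z'‖ ≤ 2 * Lpb * (1 + ‖x'‖ + mnorm1 ν') →
        ‖B x ν z - B x' ν' z'‖ ≤ C * (‖x - x'‖ + (∫ q, ‖q.1 - q.2‖ ∂π) + ‖z - z'‖)) →
      (∀ x x' ν ν' z z' π, MemP1 ν → MemP1 ν' → IsCoupling π ν ν' →
        ‖z‖ ≤ 2 * Lpb * (1 + ‖x‖ + mnorm1 ν) → ‖z'‖ ≤ 2 * Lpb * (1 + ‖x'‖ + mnorm1 ν') →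
        ‖Ψ x ν z - Ψ x' ν' z'‖ ≤ C * (‖x - x'‖ + (∫ q, ‖q.1 - q.2‖ ∂π) + ‖z - z'‖)) →
      (∀ xt xt' ν ν' x x' zt zt' π, MemP1 ν → MemP1 ν' → IsCoupling π ν ν' →
        ‖zt‖ ≤ 2 * Lpb * (1 + ‖xt‖ + mnorm1 ν) →
        ‖zt'‖ ≤ 2 * Lpb * (1 + ‖xt'‖ + mnorm1 ν') →
        ‖Φ xt ν x zt - Φ xt' ν' x' zt'‖ ≤
          C * (‖xt - xt'‖ + (∫ q, ‖q.1 - q.2‖ ∂π) + ‖x - x'‖ + ‖zt - zt'‖)) →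
      -- (iii) Lipschitz continuity of the terminal datum
      (∀ x x' ν ν' π, MemP1 ν → MemP1 ν' → IsCoupling π ν ν' →
        ‖p x ν - p x' ν'‖ ≤ Lp * (‖x - x'‖ + ∫ q, ‖q.1 - q.2‖ ∂π)) →
      ∀ t T : ℝ, 0 ≤ t → t ≤ T → T - t ≤ ε →
      ∃ γ : ℝ → EuclideanSpace ℝ (Fin d) → Measure (EuclideanSpace ℝ (Fin d)) →
          EuclideanSpace ℝ (Fin d),
        -- linear-growth bound for the decoupling field
        (∀ s ∈ Icc t T, ∀ x ν, MemP1 ν → ‖γ s x ν‖ ≤ 2 * Lpb * (1 + ‖x‖ + mnorm1 ν)) ∧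
        -- joint continuity of the decoupling field (ε–δ, with `W1` in the measure variable)
        (∀ s ∈ Icc t T, ∀ (x : EuclideanSpace ℝ (Fin d)) ν, MemP1 ν →
          ∀ e > (0:ℝ), ∃ δ > (0:ℝ), ∀ s' ∈ Icc t T,
            ∀ (x' : EuclideanSpace ℝ (Fin d)) ν', MemP1 ν' →
            |s - s'| < δ → ‖x - x'‖ < δ → W1 ν ν' < δ → ‖γ s x ν - γ s' x' ν'‖ < e) ∧
        -- for every initial pair `(s, m)` there is a flow solving the FBODE system
        ∀ s ∈ Icc t T, ∀ m, MemP1 m →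
          ∃ X : ℝ → EuclideanSpace ℝ (Fin d) → EuclideanSpace ℝ (Fin d),
            ContinuousOn (fun q : ℝ × EuclideanSpace ℝ (Fin d) => X q.1 q.2)
              (Icc s T ×ˢ (univ : Set (EuclideanSpace ℝ (Fin d)))) ∧
            -- forward equation
            (∀ τ ∈ Icc s T, ∀ x,
              X τ x = x + ∫ r in s..τ,
                B (X r x) (Measure.map (X r) m) (γ r (X r x) (Measure.map (X r) m))) ∧
            -- backward representation of the decoupling field
            (∀ x, γ s x m =
              p (X T x) (Measure.map (X T) m) +
                ∫ τ in s..T,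
                  ((∫ xt, Φ (X τ xt) (Measure.map (X τ) m) (X τ x)
                      (γ τ (X τ xt) (Measure.map (X τ) m)) ∂m) +
                    Ψ (X τ x) (Measure.map (X τ) m)
                      (γ τ (X τ x) (Measure.map (X τ) m)))) ∧
            -- cone condition for `Z^{s,m}_τ(x) = γ(τ, X_τ(x), (X_τ)_# m)`
            (∀ τ ∈ Icc s T, ∀ x,
              ‖γ τ (X τ x) (Measure.map (X τ) m)‖ ≤
                2 * Lpb * (1 + ‖X τ x‖ + ∫ y, ‖X τ y‖ ∂m)) := by
  have hLpb := hLp.trans_le hLpLpb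
  refine ⟨Lpb / (24 * C * (1 + Lpb) ^ 2), by positivity, ?_⟩
  intro d _ B Ψ Φ p hB hΨ hΦ hp hB' hΨ' hΦ' hp' t T _ _ hε
  have hc : CoeffBounds C Lp Lpb B Ψ Φ p :=
    ⟨hC, hLp, hLpLpb, hB, hΨ, hΦ, hp, hB', hΨ', hΦ', hp'⟩
  have hsmall : 24 * C * (1 + Lpb) * (T - t) ≤ Lpb / (1 + Lpb) := by
    refine (mul_le_mul_of_nonneg_left hε (by positivity)).trans_eq ?_
    field_simp
  have hε₁ : 24 * C * (1 + Lpb) * (T - t) ≤ 1 :=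
    hsmall.trans ((div_le_one (by positivity)).2 (by linarith))
  have hε₂ : 24 * C * (1 + Lpb) * (T - t) ≤ Lpb :=
    hsmall.trans (div_le_self hLpb.le (by linarith))
  obtain ⟨X, Z, h⟩ := exists_isSolutionFamily hc hε₁ hε₂
  refine ⟨fun s x m => Z s m s x, fun s hs x ν hν => ?_,
    fun s hs x ν hν e he => h.exists_norm_snd_sub_lt hc hε₁ hs x hν he, fun s hs m hm => ?_⟩
  · refine ((h.picardClass s hs ν hν).bound s (left_mem_Icc.2 hs.2) x).trans ?_
    have := mnorm1_nonneg ν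
    exact mul_le_mul_of_nonneg_right (by linarith) (by positivity)
  have hs' : s ∈ Icc s T := left_mem_Icc.2 hs.2
  have hT : T ∈ Icc s T := right_mem_Icc.2 hs.2
  have hcl := h.picardClass s hs m hm
  have hflow : ∀ τ ∈ Icc s T, ∀ x, Z τ (m.map (X s m τ)) τ (X s m τ x) = Z s m τ x :=
    fun τ hτ x => h.flow hc hε₁ hs hτ hm x
  refine ⟨X s m, hcl.continuousOn_uncurry hLpb, fun τ hτ x => ?_, fun x => ?_,
    fun τ hτ x => ?_⟩
  · rw [(h.step s hs m hm).fst τ hτ x]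
    refine congrArg (x + ·) (intervalIntegral.integral_congr fun r hr => ?_)
    simp only [drift, hflow r (uIcc_subset_Icc hs' hτ hr)]
  · change Z s m s x = _
    rw [(h.step s hs m hm).snd s hs' x]
    refine congrArg (_ + ·) (intervalIntegral.integral_congr fun r hr => ?_)
    simp only [driver, hflow r (uIcc_subset_Icc hs' hT hr)]
  · simp only [hflow τ hτ]
    exact (hcl.admissiblePath hC hLpb hm).cone τ hτ x
end
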